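/- arXiv:2507.14033 — 3 statements merged into one kernel-verified Lean document; each statement's English description precedes it below -/
import Mathlib

section
/- Let x ≤ y be dominant elements of W and let λ ∈ Λ be a dominant weight (so that x+λ and y+λ are again dominant with x+λ ≤ y+λ). Then the Bruhat intervals [x,y] and [x+λ, y+λ] have the same cardinality if and only if Pgn_{x,y} + λ = Pgn_{x+λ, y+λ}. -/
noncomputable section

open scoped RealInnerProductSpace

/-- The Bruhat strict order on a Coxeter group: the transitive closure of the relation
"multiply on the left by a reflection, increasing the length". -/
def bruhatLT {B : Type*} {W : Type*} [Group W] {M : CoxeterMatrix B}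
    (cs : CoxeterSystem M W) : W → W → Prop :=
  Relation.TransGen (fun a b => (∃ t, cs.IsReflection t ∧ b = t * a) ∧ cs.length a < cs.length b)

/-- The Bruhat order on a Coxeter group. -/
def bruhatLE {B : Type*} {W : Type*} [Group W] {M : CoxeterMatrix B}
    (cs : CoxeterSystem M W) (x y : W) : Prop :=
  x = y ∨ bruhatLT cs x y

/-- The Bruhat interval `[x, y]` as a set. -/
def Iset {B : Type*} {W : Type*} [Group W] {M : CoxeterMatrix B}
    (cs : CoxeterSystem M W) (x y : W) : Set W :=
  {z | bruhatLE cs x z ∧ bruhatLE cs z y}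

/-- The Bruhat covers `U(x)` of an element `x`. -/
def Uset {B : Type*} {W : Type*} [Group W] {M : CoxeterMatrix B}
    (cs : CoxeterSystem M W) (x : W) : Set W :=
  {w | bruhatLT cs x w ∧ cs.length w = cs.length x + 1}

/-- The Bruhat cocovers `L(y)` of an element `y`. -/
def Lset {B : Type*} {W : Type*} [Group W] {M : CoxeterMatrix B}
    (cs : CoxeterSystem M W) (y : W) : Set W :=
  {w | bruhatLT cs w y ∧ cs.length y = cs.length w + 1}

/-- An interval `[x, y]` is full if it contains all Bruhat covers of `x` and all
Bruhat cocovers of `y`. -/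
def FullInt {B : Type*} {W : Type*} [Group W] {M : CoxeterMatrix B}
    (cs : CoxeterSystem M W) (x y : W) : Prop :=
  Uset cs x ⊆ Iset cs x y ∧ Lset cs y ⊆ Iset cs x y

/-- Two Bruhat intervals (possibly in different Coxeter groups) are isomorphic as posets. -/
def IntervalIso {B : Type*} {W : Type*} {B' : Type*} {W' : Type*} [Group W] [Group W']
    {M : CoxeterMatrix B} {M' : CoxeterMatrix B'}
    (cs : CoxeterSystem M W) (cs' : CoxeterSystem M' W') (x y : W) (x' y' : W') : Prop :=
  ∃ f : {z : W // bruhatLE cs x z ∧ bruhatLE cs z y} ≃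
        {z : W' // bruhatLE cs' x' z ∧ bruhatLE cs' z y'},
    ∀ u v, bruhatLE cs u.1 v.1 ↔ bruhatLE cs' (f u).1 (f v).1

/-- The group `G` of generic automorphisms: the subgroup of the permutation group of `W`
generated by the Dynkin diagram automorphisms `δ`, `σ` and inversion. -/
def Gsub {W : Type*} [Group W] (dl sg : W ≃* W) : Subgroup (Equiv.Perm W) :=
  Subgroup.closure {dl.toEquiv, sg.toEquiv, Equiv.inv W}

/-- The Euclidean plane, with coordinates taken in the basis of simple roots of `A₂`. -/
abbrev E2 : Type := ℝ × ℝ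

/-- The `A₂` inner product on the plane, in which `(αᵢ, αᵢ) = 2` and `(α₁, α₂) = -1`. -/
def B2 (u v : E2) : ℝ := 2*u.1*v.1 - u.1*v.2 - u.2*v.1 + 2*u.2*v.2

/-- The simple root `α₁`. -/
def a1 : E2 := (1, 0)
/-- The simple root `α₂`. -/
def a2 : E2 := (0, 1)
/-- The fundamental weight `ϖ₁`, satisfying `(αᵢ, ϖⱼ) = δᵢⱼ`. -/
def fw1 : E2 := (2/3, 1/3)
/-- The fundamental weight `ϖ₂`. -/
def fw2 : E2 := (1/3, 2/3)
/-- `ρ = ϖ₁ + ϖ₂ = α₁ + α₂`. -/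
def rho2 : E2 := (1, 1)

/-- The affine reflection `s_{α,k}` of the plane in the line `{v | (α, v) = k}`,
for a root `α` with `(α, α) = 2`. -/
def reflE (a : E2) (k : ℝ) (v : E2) : E2 := v - (B2 a v - k) • a

/-- The barycenter of the alcove of `z`, i.e. the image under the affine action of `z` of
the barycenter `-ρ/3` of the fundamental alcove (whose vertices are `0, -ϖ₁, -ϖ₂`). -/
def cen {W : Type*} [Group W] (act : W →* Equiv.Perm E2) (z : W) : E2 :=
  act z ((-(1/3 : ℝ)) • rho2)

/-- The weight lattice `Λ = ℤϖ₁ ⊕ ℤϖ₂`. -/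
def wLat : Set E2 := {v | ∃ a b : ℤ, v = (a : ℝ) • fw1 + (b : ℝ) • fw2}

/-- The fundamental alcove `A₊`. -/
def AlcoveFund : Set E2 :=
  {v | (-1 < B2 a1 v ∧ B2 a1 v < 0) ∧ (-1 < B2 a2 v ∧ B2 a2 v < 0) ∧
    (-1 < B2 rho2 v ∧ B2 rho2 v < 0)}

/-- The zone `F_id` of the plane. -/
def Fid : Set E2 := {v | -1 ≤ B2 a1 v ∧ -1 ≤ B2 a2 v ∧ -1 ≤ B2 rho2 v}

/-- The cone `K` of nonnegative combinations of the simple roots. -/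
def coneK : Set E2 := {v | ∃ a b : ℝ, 0 ≤ a ∧ 0 ≤ b ∧ v = a • a1 + b • a2}

/-- The set `D` of dominant elements, given functions `θ, θˢ` enumerating them. -/
def Dset {W : Type*} (th ths : ℕ → ℕ → W) : Set W :=
  {w | (∃ m n, w = th m n) ∨ (∃ m n, w = ths m n)}

/-- The polygon `Pgn_{x,y} = F_id ∩ (cen x + K) ∩ (cen y - K)`. -/
def Pgn {W : Type*} [Group W] (act : W →* Equiv.Perm E2) (x y : W) : Set E2 :=
  {v ∈ Fid | (∃ k ∈ coneK, v = cen act x + k) ∧ (∃ k ∈ coneK, v = cen act y - k)}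

/-- The element `x_k`: the product of the first `k` terms of `s₁, s₂, s₀, s₁, s₂, s₀, …`. -/
def xelt {W : Type*} [Group W] {M : CoxeterMatrix (Fin 3)} (cs : CoxeterSystem M W)
    (k : ℕ) : W :=
  ((List.range k).map (fun j => cs.simple (⟨(j + 1) % 3, Nat.mod_lt _ (by norm_num)⟩ : Fin 3))).prod

/-- `zoneOf cs w v` says that `w` is one of the six elements of `W_f` and `v` lies in the
corresponding zone `F_w` of the plane. -/
def zoneOf {W : Type*} [Group W] {M : CoxeterMatrix (Fin 3)} (cs : CoxeterSystem M W)
    (w : W) (v : E2) : Prop :=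
  (w = 1 ∧ v ∈ Fid) ∨
  (w = cs.simple 1 ∧ B2 a1 v ≤ -1 ∧ -1 ≤ B2 rho2 v) ∨
  (w = cs.simple 2 ∧ B2 a2 v ≤ -1 ∧ -1 ≤ B2 rho2 v) ∨
  (w = cs.simple 1 * cs.simple 2 ∧ B2 rho2 v ≤ -1 ∧ 0 ≤ B2 a2 v) ∨
  (w = cs.simple 2 * cs.simple 1 ∧ B2 rho2 v ≤ -1 ∧ 0 ≤ B2 a1 v) ∨
  (w = cs.simple 1 * cs.simple 2 * cs.simple 1 ∧ B2 a1 v ≤ 0 ∧ B2 a2 v ≤ 0)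

/-- Thickness of the interval `[x,y]`: `x + 2αᵢ` and `y - 2αᵢ` belong to `[x,y]` and their
barycenters lie in `F_id`, for `i = 1, 2`. -/
def Thick {W : Type*} [Group W] {M : CoxeterMatrix (Fin 3)} (cs : CoxeterSystem M W)
    (act : W →* Equiv.Perm E2) (Wadd : W → E2 → W) (x y : W) : Prop :=
  Wadd x ((2 : ℝ) • a1) ∈ Iset cs x y ∧ Wadd x ((2 : ℝ) • a2) ∈ Iset cs x y ∧
  Wadd y (-((2 : ℝ) • a1)) ∈ Iset cs x y ∧ Wadd y (-((2 : ℝ) • a2)) ∈ Iset cs x y ∧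
  cen act (Wadd x ((2 : ℝ) • a1)) ∈ Fid ∧ cen act (Wadd x ((2 : ℝ) • a2)) ∈ Fid ∧
  cen act (Wadd y (-((2 : ℝ) • a1))) ∈ Fid ∧ cen act (Wadd y (-((2 : ℝ) • a2))) ∈ Fid

/-! ### Integer coordinates for alcoves

An alcove is encoded by three times its barycenter, written in the basis of simple roots. -/

/-- Three times the pairing with `ρ`, `α₁`, `α₂` respectively. -/
def rootVal : Fin 3 → ℤ × ℤ → ℤ
  | 0, z => z.1 + z.2
  | 1, z => 2 * z.1 - z.2
  | 2, z => 2 * z.2 - z.1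

/-- The affine reflections in the lines `H_{ρ,k}`, `H_{α₁,k}`, `H_{α₂,k}`. -/
def affRefl : Fin 3 → ℤ → ℤ × ℤ → ℤ × ℤ
  | 0, k, z => (3 * k - z.2, 3 * k - z.1)
  | 1, k, z => (z.2 - z.1 + 3 * k, z.2)
  | 2, k, z => (z.1, z.1 - z.2 + 3 * k)

/-- The alcove lies on the same side of the line as the fundamental alcove. -/
def Ascends (i : Fin 3) (k : ℤ) (z : ℤ × ℤ) : Prop :=
  (0 ≤ k ∧ rootVal i z < 3 * k) ∨ (k < 0 ∧ 3 * k < rootVal i z)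

/-- The pairs which are coordinates of alcoves. -/
def IsAlcove (z : ℤ × ℤ) : Prop := (z.1 + z.2) % 3 ≠ 0

/-- The dominance condition on coordinates. -/
def IsDom (z : ℤ × ℤ) : Prop := 0 < 2 * z.1 - z.2 ∧ 0 < 2 * z.2 - z.1

/-- The number of lines of a given direction separating an alcove from the fundamental one. -/
def sepCount (c : ℤ) : ℤ := max (c / 3 + 1) (-(c / 3 + 1))

/-- The number of lines separating an alcove from the fundamental one. -/
def sepTotal (z : ℤ × ℤ) : ℤ :=
  sepCount (rootVal 0 z) + sepCount (rootVal 1 z) + sepCount (rootVal 2 z)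

/-- The alcoves below a dominant alcove `y`. -/
def BelowDom (y z : ℤ × ℤ) : Prop :=
  (z.1 ≤ y.1 ∧ z.2 - z.1 ≤ y.1 ∧ -z.2 ≤ y.1) ∧ (z.2 ≤ y.2 ∧ z.1 - z.2 ≤ y.2 ∧ -z.1 ≤ y.2)

/-- The alcoves above a dominant alcove `x`, described zone by zone. -/
def AboveDom (x z : ℤ × ℤ) : Prop :=
  ((-3 ≤ 2 * z.1 - z.2 ∧ -3 ≤ 2 * z.2 - z.1 ∧ -3 ≤ z.1 + z.2) ∧ x.1 ≤ z.1 ∧ x.2 ≤ z.2) ∨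
  ((2 * z.1 - z.2 ≤ -3 ∧ -3 ≤ z.1 + z.2) ∧ x.1 ≤ z.2 - z.1 - 3 ∧ x.2 ≤ z.2) ∨
  ((2 * z.2 - z.1 ≤ -3 ∧ -3 ≤ z.1 + z.2) ∧ x.1 ≤ z.1 ∧ x.2 ≤ z.1 - z.2 - 3) ∨
  ((z.1 + z.2 ≤ -3 ∧ 0 ≤ 2 * z.2 - z.1) ∧ x.1 ≤ z.2 - z.1 - 3 ∧ x.2 ≤ -z.1 - 3) ∨
  ((z.1 + z.2 ≤ -3 ∧ 0 ≤ 2 * z.1 - z.2) ∧ x.1 ≤ -z.2 - 3 ∧ x.2 ≤ z.1 - z.2 - 3) ∨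
  ((z.1 + z.2 ≤ -3 ∧ 2 * z.1 - z.2 ≤ 0 ∧ 2 * z.2 - z.1 ≤ 0) ∧
    x.1 ≤ -z.2 - 3 ∧ x.2 ≤ -z.1 - 3)

lemma affRefl_affRefl (i : Fin 3) (k : ℤ) (z : ℤ × ℤ) : affRefl i k (affRefl i k z) = z := by
  obtain ⟨u, v⟩ := z
  fin_cases i <;> ext <;> simp only [affRefl] <;> ring

lemma IsAlcove.reflect {z : ℤ × ℤ} (hz : IsAlcove z) (i : Fin 3) (k : ℤ) :
    IsAlcove (affRefl i k z) := by
  obtain ⟨u, v⟩ := z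
  fin_cases i <;> simp only [IsAlcove, affRefl] at * <;> omega

lemma ascends_or_ascends_affRefl {z : ℤ × ℤ} (hz : IsAlcove z) (i : Fin 3) (k : ℤ) :
    Ascends i k z ∨ Ascends i k (affRefl i k z) := by
  obtain ⟨u, v⟩ := z
  fin_cases i <;> simp only [IsAlcove, affRefl, Ascends, rootVal] at * <;> omega

lemma IsAlcove.exists_param {z : ℤ × ℤ} (hz : IsAlcove z) :
    ∃ p q e : ℤ, (e = 1 ∨ e = 2) ∧ z = (2 * p + q + e, p + 2 * q + e) := by
  obtain ⟨u, v⟩ := z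
  simp only [IsAlcove] at hz
  refine ⟨(2 * u - v) / 3, (2 * v - u) / 3, (2 * u - v) % 3, by omega, ?_⟩
  rw [Prod.mk.injEq]
  omega

lemma sepTotal_nonneg (z : ℤ × ℤ) : 0 ≤ sepTotal z := by
  simp only [sepTotal, sepCount]
  omega

lemma sepTotal_param (p q e : ℤ) (he : e = 1 ∨ e = 2) :
    sepTotal (2 * p + q + e, p + 2 * q + e) = |p + 1| + |q + 1| + |p + q + e| := by
  have hr : (2 * p + q + e + (p + 2 * q + e)) / 3 + 1 = p + q + e := by omega
  have hp : (2 * (2 * p + q + e) - (p + 2 * q + e)) / 3 + 1 = p + 1 := by omega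
  have hq : (2 * (p + 2 * q + e) - (2 * p + q + e)) / 3 + 1 = q + 1 := by omega
  simp only [sepTotal, sepCount, rootVal, hr, hp, hq, ← abs_eq_max_neg]
  ring

/-- The action of an affine reflection on the parameters of `IsAlcove.exists_param`. -/
lemma affRefl_param (p q e k : ℤ) :
    affRefl 0 k (2 * p + q + e, p + 2 * q + e) =
      (2 * (k - q - 1) + (k - p - 1) + (3 - e), (k - q - 1) + 2 * (k - p - 1) + (3 - e)) ∧
    affRefl 1 k (2 * p + q + e, p + 2 * q + e) =
      (2 * (2 * k - p - 1) + (p + q - k + e - 1) + (3 - e),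
        (2 * k - p - 1) + 2 * (p + q - k + e - 1) + (3 - e)) ∧
    affRefl 2 k (2 * p + q + e, p + 2 * q + e) =
      (2 * (p + q - k + e - 1) + (2 * k - q - 1) + (3 - e),
        (p + q - k + e - 1) + 2 * (2 * k - q - 1) + (3 - e)) := by
  simp only [affRefl, Prod.mk.injEq]
  refine ⟨⟨?_, ?_⟩, ⟨?_, ?_⟩, ?_, ?_⟩ <;> ring

lemma sepTotal_affRefl_param (p q e k : ℤ) (he : e = 1 ∨ e = 2) :
    sepTotal (affRefl 0 k (2 * p + q + e, p + 2 * q + e)) =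
      |k - q| + |k - p| + |2 * k - p - q + 1 - e| ∧
    sepTotal (affRefl 1 k (2 * p + q + e, p + 2 * q + e)) =
      |2 * k - p| + |p + q - k + e| + |k + q + 1| ∧
    sepTotal (affRefl 2 k (2 * p + q + e, p + 2 * q + e)) =
      |p + q - k + e| + |2 * k - q| + |k + p + 1| := by
  have he' : 3 - e = 1 ∨ 3 - e = 2 := by omega
  obtain ⟨h0, h1, h2⟩ := affRefl_param p q e k
  rw [h0, h1, h2, sepTotal_param _ _ _ he', sepTotal_param _ _ _ he', sepTotal_param _ _ _ he']
  refine ⟨?_, ?_, ?_⟩ <;> ring_nf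

lemma sepTotal_lt_of_ascends {z : ℤ × ℤ} (hz : IsAlcove z) {i : Fin 3} {k : ℤ}
    (h : Ascends i k z) : sepTotal z < sepTotal (affRefl i k z) := by
  obtain ⟨p, q, e, he, rfl⟩ := hz.exists_param
  obtain ⟨h0, h1, h2⟩ := sepTotal_affRefl_param p q e k he
  fin_cases i
  · simp only [Fin.zero_eta, Ascends, rootVal] at h ⊢
    have : 0 ≤ k ∧ p + q + e ≤ k ∨ k < 0 ∧ k < p + q + e := by omega
    rw [h0, sepTotal_param _ _ _ he]
    clear h h0 h1 h2
    simp only [abs_eq_max_neg]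
    rcases this with ⟨ha, hb⟩ | ⟨ha, hb⟩ <;> omega
  · simp only [Fin.mk_one, Ascends, rootVal] at h ⊢
    have : 0 ≤ k ∧ p < k ∨ k < 0 ∧ k ≤ p := by omega
    rw [h1, sepTotal_param _ _ _ he]
    clear h h0 h1 h2
    simp only [abs_eq_max_neg]
    rcases this with ⟨ha, hb⟩ | ⟨ha, hb⟩ <;> omega
  · simp only [Fin.reduceFinMk, Ascends, rootVal] at h ⊢
    have : 0 ≤ k ∧ q < k ∨ k < 0 ∧ k ≤ q := by omega
    rw [h2, sepTotal_param _ _ _ he]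
    clear h h0 h1 h2
    simp only [abs_eq_max_neg]
    rcases this with ⟨ha, hb⟩ | ⟨ha, hb⟩ <;> omega

lemma sepTotal_simple_le {z : ℤ × ℤ} (hz : IsAlcove z) (i : Fin 3) :
    sepTotal (affRefl i (if i = 0 then -1 else 0) z) ≤ sepTotal z + 1 := by
  obtain ⟨p, q, e, he, rfl⟩ := hz.exists_param
  rw [sepTotal_param _ _ _ he]
  fin_cases i
  · simp only [Fin.zero_eta, if_true, (sepTotal_affRefl_param p q e (-1) he).1, abs_eq_max_neg]
    omega
  · simp only [Fin.mk_one, one_ne_zero, if_false, (sepTotal_affRefl_param p q e 0 he).2.1,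
      abs_eq_max_neg]
    omega
  · simp only [Fin.reduceFinMk, Fin.reduceEq, if_false, (sepTotal_affRefl_param p q e 0 he).2.2,
      abs_eq_max_neg]
    omega

lemma exists_simple_sepTotal_lt {z : ℤ × ℤ} (hz : IsAlcove z) (h1 : z ≠ (-1, -1)) :
    ∃ i : Fin 3, sepTotal (affRefl i (if i = 0 then -1 else 0) z) < sepTotal z := by
  have key : ∀ i : Fin 3, Ascends i (if i = 0 then -1 else 0)
      (affRefl i (if i = 0 then -1 else 0) z) →
      sepTotal (affRefl i (if i = 0 then -1 else 0) z) < sepTotal z := by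
    intro i h
    simpa only [affRefl_affRefl] using sepTotal_lt_of_ascends (hz.reflect _ _) h
  by_contra! hc
  have hn : ∀ i : Fin 3, ¬ Ascends i (if i = 0 then -1 else 0)
      (affRefl i (if i = 0 then -1 else 0) z) := fun i h => (key i h).not_ge (hc i)
  have := hn 0; have := hn 1; have := hn 2
  obtain ⟨u, v⟩ := z
  simp [IsAlcove, affRefl, Ascends, rootVal] at *
  omega

lemma BelowDom.of_ascends {y z : ℤ × ℤ} (hz : IsAlcove z) {i : Fin 3} {k : ℤ}
    (h : Ascends i k z) (hb : BelowDom y (affRefl i k z)) : BelowDom y z := by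
  obtain ⟨u, v⟩ := z
  fin_cases i <;>
    simp only [IsAlcove, affRefl, Ascends, rootVal, BelowDom] at * <;>
    omega

lemma AboveDom.of_zones {x z : ℤ × ℤ}
    (h0 : -3 ≤ 2 * z.1 - z.2 → -3 ≤ 2 * z.2 - z.1 → -3 ≤ z.1 + z.2 → x.1 ≤ z.1 ∧ x.2 ≤ z.2)
    (h1 : 2 * z.1 - z.2 ≤ -3 → -3 ≤ z.1 + z.2 → x.1 ≤ z.2 - z.1 - 3 ∧ x.2 ≤ z.2)
    (h2 : 2 * z.2 - z.1 ≤ -3 → -3 ≤ z.1 + z.2 → x.1 ≤ z.1 ∧ x.2 ≤ z.1 - z.2 - 3)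
    (h12 : z.1 + z.2 ≤ -3 → 0 ≤ 2 * z.2 - z.1 → x.1 ≤ z.2 - z.1 - 3 ∧ x.2 ≤ -z.1 - 3)
    (h21 : z.1 + z.2 ≤ -3 → 0 ≤ 2 * z.1 - z.2 → x.1 ≤ -z.2 - 3 ∧ x.2 ≤ z.1 - z.2 - 3)
    (h121 : z.1 + z.2 ≤ -3 → 2 * z.1 - z.2 ≤ 0 → 2 * z.2 - z.1 ≤ 0 →
      x.1 ≤ -z.2 - 3 ∧ x.2 ≤ -z.1 - 3) : AboveDom x z := by
  unfold AboveDom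
  rcases le_total (-3) (z.1 + z.2) with hr | hr
  · rcases le_total (-3) (2 * z.1 - z.2) with hp | hp
    · rcases le_total (-3) (2 * z.2 - z.1) with hq | hq
      · exact Or.inl ⟨⟨hp, hq, hr⟩, h0 hp hq hr⟩
      · exact Or.inr (Or.inr (Or.inl ⟨⟨hq, hr⟩, h2 hq hr⟩))
    · exact Or.inr (Or.inl ⟨⟨hp, hr⟩, h1 hp hr⟩)
  · rcases le_total 0 (2 * z.2 - z.1) with hq | hq
    · exact Or.inr (Or.inr (Or.inr (Or.inl ⟨⟨hr, hq⟩, h12 hr hq⟩)))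
    · rcases le_total 0 (2 * z.1 - z.2) with hp | hp
      · exact Or.inr (Or.inr (Or.inr (Or.inr (Or.inl ⟨⟨hr, hp⟩, h21 hr hp⟩))))
      · exact Or.inr (Or.inr (Or.inr (Or.inr (Or.inr ⟨⟨hr, hp, hq⟩, h121 hr hp hq⟩))))

lemma AboveDom.reflect {x z : ℤ × ℤ} (hx : IsDom x) (hz : IsAlcove z) {i : Fin 3} {k : ℤ}
    (h : Ascends i k z) (hb : AboveDom x z) : AboveDom x (affRefl i k z) := by
  obtain ⟨u, v⟩ := z
  obtain ⟨a, b⟩ := x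
  apply AboveDom.of_zones <;>
  rcases hb with hb | hb | hb | hb | hb | hb <;> fin_cases i <;>
    simp only [IsAlcove, affRefl, Ascends, rootVal, IsDom] at * <;> intros <;> omega

lemma AboveDom.self {x : ℤ × ℤ} (hx : IsDom x) : AboveDom x x := by
  simp only [IsDom] at hx
  exact Or.inl ⟨by omega, le_rfl, le_rfl⟩

lemma BelowDom.self {y : ℤ × ℤ} (hy : IsDom y) : BelowDom y y := by
  simp only [IsDom, BelowDom] at *
  omega

lemma BelowDom.exists_ascends {y z : ℤ × ℤ} (hya : IsAlcove y) (hz : IsAlcove z)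
    (hy : IsDom y) (hb : BelowDom y z) (hne : z ≠ y) :
    ∃ i k, Ascends i k z ∧ BelowDom y (affRefl i k z) := by
  obtain ⟨u, v⟩ := z
  obtain ⟨c, d⟩ := y
  rw [Ne, Prod.mk.injEq] at hne
  simp only [IsAlcove, IsDom, BelowDom] at *
  by_cases hp : 2 * u - v < 0
  · refine ⟨1, 0, ?_⟩
    simp only [Ascends, rootVal, affRefl]
    omega
  by_cases hq : 2 * v - u < 0
  · refine ⟨2, 0, ?_⟩
    simp only [Ascends, rootVal, affRefl]
    omega
  have key : (∃ k, 0 ≤ k ∧ u + v < 3 * k ∧ 3 * k - v ≤ c ∧ 3 * k - u ≤ d) ∨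
      (∃ k, 0 ≤ k ∧ 2 * u - v < 3 * k ∧ v - u + 3 * k ≤ c ∧ 3 * k - u ≤ d) ∨
      (∃ k, 0 ≤ k ∧ 2 * v - u < 3 * k ∧ u - v + 3 * k ≤ d ∧ 3 * k - v ≤ c) := by
    have hr : (u + v) % 3 = 1 ∨ (u + v) % 3 = 2 := by omega
    rcases hr with hr | hr
    · by_cases h1 : u < c
      · exact Or.inr (Or.inl ⟨(2 * u - v) / 3 + 1, by omega⟩)
      · exact Or.inr (Or.inr ⟨(2 * v - u) / 3 + 1, by omega⟩)
    · by_cases h1 : c = u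
      · exact Or.inr (Or.inr ⟨(2 * v - u) / 3 + 1, by omega⟩)
      by_cases h2 : d = v
      · exact Or.inr (Or.inl ⟨(2 * u - v) / 3 + 1, by omega⟩)
      · exact Or.inl ⟨(u + v) / 3 + 1, by omega⟩
  rcases key with ⟨k, hk⟩ | ⟨k, hk⟩ | ⟨k, hk⟩
  · refine ⟨0, k, ?_⟩
    simp only [Ascends, rootVal, affRefl]
    omega
  · refine ⟨1, k, ?_⟩
    simp only [Ascends, rootVal, affRefl]
    omega
  · refine ⟨2, k, ?_⟩
    simp only [Ascends, rootVal, affRefl]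
    omega

lemma AboveDom.exists_ascends {x z : ℤ × ℤ} (hxa : IsAlcove x) (hz : IsAlcove z)
    (hx : IsDom x) (hb : AboveDom x z) (hne : z ≠ x) :
    ∃ i k, Ascends i k (affRefl i k z) ∧ AboveDom x (affRefl i k z) := by
  obtain ⟨u, v⟩ := z
  obtain ⟨a, b⟩ := x
  rw [Ne, Prod.mk.injEq] at hne
  simp only [IsAlcove, IsDom] at *
  rcases hb with hb | hb | hb | hb | hb | hb <;> simp only at hb
  · have key : (∃ k, 0 ≤ k ∧ 3 * k < u + v ∧ a ≤ 3 * k - v ∧ b ≤ 3 * k - u ∧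
          -3 ≤ 3 * k - 2 * v + u ∧ -3 ≤ 3 * k - 2 * u + v) ∨
        (∃ k, 0 ≤ k ∧ 3 * k < 2 * u - v ∧ a ≤ v - u + 3 * k ∧ -3 ≤ 6 * k - 2 * u + v) ∨
        (∃ k, 0 ≤ k ∧ 3 * k < 2 * v - u ∧ b ≤ u - v + 3 * k ∧ -3 ≤ 6 * k - 2 * v + u) := by
      by_cases h1 : 0 < 2 * u - v ∧ a ≤ v - u + 3 * ((2 * u - v) / 3)
      · exact Or.inr (Or.inl ⟨(2 * u - v) / 3, by omega⟩)
      by_cases h2 : 0 < 2 * v - u ∧ b ≤ u - v + 3 * ((2 * v - u) / 3)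
      · exact Or.inr (Or.inr ⟨(2 * v - u) / 3, by omega⟩)
      · exact Or.inl ⟨(u + v) / 3, by omega⟩
    rcases key with ⟨k, hk⟩ | ⟨k, hk⟩ | ⟨k, hk⟩
    · refine ⟨0, k, ?_, Or.inl ?_⟩ <;> simp only [Ascends, rootVal, affRefl] <;> omega
    · refine ⟨1, k, ?_, Or.inl ?_⟩ <;> simp only [Ascends, rootVal, affRefl] <;> omega
    · refine ⟨2, k, ?_, Or.inl ?_⟩ <;> simp only [Ascends, rootVal, affRefl] <;> omega
  · refine ⟨1, -1, ?_, Or.inl ?_⟩ <;> simp only [Ascends, rootVal, affRefl] <;> omega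
  · refine ⟨2, -1, ?_, Or.inl ?_⟩ <;> simp only [Ascends, rootVal, affRefl] <;> omega
  · refine ⟨0, -1, ?_, Or.inr (Or.inl ?_)⟩ <;> simp only [Ascends, rootVal, affRefl] <;> omega
  · refine ⟨0, -1, ?_, Or.inr (Or.inr (Or.inl ?_))⟩ <;>
      simp only [Ascends, rootVal, affRefl] <;> omega
  · refine ⟨0, -1, ?_, Or.inl ?_⟩ <;> simp only [Ascends, rootVal, affRefl] <;> omega

/-! ### Counting alcoves -/

/-- The alcoves lying between two dominant ones. -/
def alcoveInterval (x y : ℤ × ℤ) : Set (ℤ × ℤ) :=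
  {z | IsAlcove z ∧ AboveDom x z ∧ BelowDom y z}

lemma alcoveInterval_finite (x y : ℤ × ℤ) : (alcoveInterval x y).Finite := by
  apply (Set.finite_Icc (-y.2, -y.1) y).subset
  rintro z ⟨-, -, hz⟩
  obtain ⟨u, v⟩ := z
  obtain ⟨c, d⟩ := y
  simp only [BelowDom, Set.mem_Icc, Prod.mk_le_mk] at *
  omega

/-- Coordinates of the weight `a ϖ₁ + b ϖ₂`. -/
def wtCoord (a b : ℤ) : ℤ × ℤ := (2 * a + b, a + 2 * b)

/-- Translation by `w (a ϖ₁ + b ϖ₂)` on the zone attached to `w ∈ W_f`. -/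
def zoneShift (a b : ℤ) (z : ℤ × ℤ) : ℤ × ℤ :=
  if -3 ≤ z.1 + z.2 then
    if 2 * z.1 - z.2 ≤ -3 then (z.1 + (b - a), z.2 + (a + 2 * b))
    else if 2 * z.2 - z.1 ≤ -3 then (z.1 + (2 * a + b), z.2 + (a - b))
    else (z.1 + (2 * a + b), z.2 + (a + 2 * b))
  else if 0 ≤ 2 * z.2 - z.1 then (z.1 - (a + 2 * b), z.2 + (a - b))
  else if 0 ≤ 2 * z.1 - z.2 then (z.1 + (b - a), z.2 - (2 * a + b))
  else (z.1 - (a + 2 * b), z.2 - (2 * a + b))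

lemma IsAlcove.shift {z : ℤ × ℤ} (hz : IsAlcove z) (a b : ℤ) :
    IsAlcove (zoneShift a b z) := by
  simp only [IsAlcove, zoneShift] at *
  split_ifs <;> simp only <;> omega

lemma IsDom.add_wtCoord {x : ℤ × ℤ} (hx : IsDom x) {a b : ℤ} (ha : 0 ≤ a) (hb : 0 ≤ b) :
    IsDom (x + wtCoord a b) := by
  simp only [IsDom, wtCoord, Prod.fst_add, Prod.snd_add] at *
  omega

lemma zoneShift_neg_zoneShift {z : ℤ × ℤ} (hz : IsAlcove z) {a b : ℤ} (ha : 0 ≤ a)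
    (hb : 0 ≤ b) : zoneShift (-a) (-b) (zoneShift a b z) = z := by
  obtain ⟨u, v⟩ := z
  simp only [IsAlcove, zoneShift] at *
  split_ifs <;> simp only [Prod.mk.injEq] at * <;> omega

lemma zoneShift_mem {x y z : ℤ × ℤ} (hy : IsDom y) {a b : ℤ} (ha : 0 ≤ a)
    (hb : 0 ≤ b) (h : z ∈ alcoveInterval x y) :
    zoneShift a b z ∈ alcoveInterval (x + wtCoord a b) (y + wtCoord a b) := by
  obtain ⟨hz, hab, hbe⟩ := h
  refine ⟨hz.shift a b, ?_, ?_⟩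
  · obtain ⟨u, v⟩ := z
    obtain ⟨x1, x2⟩ := x
    apply AboveDom.of_zones <;>
    rcases hab with h | h | h | h | h | h <;>
    simp only [IsAlcove, zoneShift, wtCoord, Prod.fst_add, Prod.snd_add] at * <;>
    split_ifs <;> intros <;> simp only at * <;> omega
  · obtain ⟨u, v⟩ := z
    obtain ⟨y1, y2⟩ := y
    simp only [IsAlcove, IsDom, BelowDom, zoneShift, wtCoord, Prod.fst_add, Prod.snd_add] at *
    split_ifs <;> simp only <;> omega

/-- The alcoves of the translated interval are all obtained by shifting the zones when the
parallelogram spanned by `x` and `y` stays in the relevant half-planes. -/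
lemma exists_zoneShift_eq {x y z : ℤ × ℤ} (hx : IsDom x) (hy : IsDom y) {a b : ℤ}
    (h1 : a = 0 ∨ -3 ≤ 2 * x.1 - y.2) (h2 : b = 0 ∨ -3 ≤ 2 * x.2 - y.1)
    (h : z ∈ alcoveInterval (x + wtCoord a b) (y + wtCoord a b)) :
    ∃ t ∈ alcoveInterval x y, zoneShift a b t = z := by
  obtain ⟨hz, hab, hbe⟩ := h
  obtain ⟨u, v⟩ := z
  obtain ⟨x1, x2⟩ := x
  obtain ⟨y1, y2⟩ := y
  simp only [IsAlcove, IsDom, BelowDom, AboveDom, wtCoord, Prod.fst_add, Prod.snd_add] at *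
  rcases hab with h | h | h | h | h | h
  · refine ⟨(u - (2 * a + b), v - (a + 2 * b)), ⟨?_, Or.inl ?_, ?_⟩, ?_⟩
    · simp only [IsAlcove]
      omega
    · simp only
      omega
    · simp only [BelowDom]
      omega
    · simp only [zoneShift]
      split_ifs <;> simp only [Prod.mk.injEq] <;> omega
  · refine ⟨(u - (b - a), v - (a + 2 * b)), ⟨?_, Or.inr (Or.inl ?_), ?_⟩, ?_⟩
    · simp only [IsAlcove]
      omega
    · simp only
      omega
    · simp only [BelowDom]
      omega
    · simp only [zoneShift]
      split_ifs <;> simp only [Prod.mk.injEq] <;> omega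
  · refine ⟨(u - (2 * a + b), v - (a - b)), ⟨?_, Or.inr (Or.inr (Or.inl ?_)), ?_⟩, ?_⟩
    · simp only [IsAlcove]
      omega
    · simp only
      omega
    · simp only [BelowDom]
      omega
    · simp only [zoneShift]
      split_ifs <;> simp only [Prod.mk.injEq] <;> omega
  · refine ⟨(u + (a + 2 * b), v - (a - b)), ⟨?_, Or.inr (Or.inr (Or.inr (Or.inl ?_))), ?_⟩, ?_⟩
    · simp only [IsAlcove]
      omega
    · simp only
      omega
    · simp only [BelowDom]
      omega
    · simp only [zoneShift]
      split_ifs <;> simp only [Prod.mk.injEq] <;> omega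
  · refine ⟨(u - (b - a), v + (2 * a + b)), ⟨?_, Or.inr (Or.inr (Or.inr (Or.inr (Or.inl ?_)))), ?_⟩, ?_⟩
    · simp only [IsAlcove]
      omega
    · simp only
      omega
    · simp only [BelowDom]
      omega
    · simp only [zoneShift]
      split_ifs <;> simp only [Prod.mk.injEq] <;> omega
  · refine ⟨(u + (a + 2 * b), v + (2 * a + b)), ⟨?_, Or.inr (Or.inr (Or.inr (Or.inr (Or.inr ?_)))), ?_⟩, ?_⟩
    · simp only [IsAlcove]
      omega
    · simp only
      omega
    · simp only [BelowDom]
      omega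
    · simp only [zoneShift]
      split_ifs <;> simp only [Prod.mk.injEq] <;> omega

lemma exists_mem_alcoveInterval_not_shift {x y : ℤ × ℤ} (hx : IsDom x) (hy : IsDom y)
    (h1 : x.1 ≤ y.1) (h2 : x.2 ≤ y.2) {a b : ℤ} (ha : 0 ≤ a) (hb : 0 ≤ b)
    (h : (a ≠ 0 ∧ 2 * x.1 - y.2 < -3) ∨ (b ≠ 0 ∧ 2 * x.2 - y.1 < -3)) :
    ∃ z ∈ alcoveInterval (x + wtCoord a b) (y + wtCoord a b), ∀ t, zoneShift a b t ≠ z := by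
  obtain ⟨x1, x2⟩ := x
  obtain ⟨y1, y2⟩ := y
  simp only [IsDom] at *
  rcases h with h | h
  · refine ⟨(x1 + 2 * a + b, 2 * x1 + a + 2 * b + 4), ⟨?_, Or.inl ?_, ?_⟩, ?_⟩
    · simp only [IsAlcove]
      omega
    · simp only [wtCoord, Prod.fst_add, Prod.snd_add]
      omega
    · simp only [BelowDom, wtCoord, Prod.fst_add, Prod.snd_add]
      omega
    · rintro ⟨u, v⟩
      simp only [zoneShift]
      split_ifs <;> simp only [ne_eq, Prod.mk.injEq] <;> omega
  · refine ⟨(2 * x2 + 2 * a + b + 4, x2 + a + 2 * b), ⟨?_, Or.inl ?_, ?_⟩, ?_⟩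
    · simp only [IsAlcove]
      omega
    · simp only [wtCoord, Prod.fst_add, Prod.snd_add]
      omega
    · simp only [BelowDom, wtCoord, Prod.fst_add, Prod.snd_add]
      omega
    · rintro ⟨u, v⟩
      simp only [zoneShift]
      split_ifs <;> simp only [ne_eq, Prod.mk.injEq] <;> omega

theorem ncard_alcoveInterval_eq_iff {x y : ℤ × ℤ} (hx : IsDom x) (hy : IsDom y)
    (h1 : x.1 ≤ y.1) (h2 : x.2 ≤ y.2) {a b : ℤ} (ha : 0 ≤ a) (hb : 0 ≤ b) :
    (alcoveInterval x y).ncard =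
        (alcoveInterval (x + wtCoord a b) (y + wtCoord a b)).ncard ↔
      (a = 0 ∨ -3 ≤ 2 * x.1 - y.2) ∧ (b = 0 ∨ -3 ≤ 2 * x.2 - y.1) := by
  have hinj : Set.InjOn (zoneShift a b) (alcoveInterval x y) := by
    intro s hs t ht hst
    rw [← zoneShift_neg_zoneShift hs.1 ha hb, hst, zoneShift_neg_zoneShift ht.1 ha hb]
  have hsub : zoneShift a b '' alcoveInterval x y ⊆
      alcoveInterval (x + wtCoord a b) (y + wtCoord a b) := by
    rintro _ ⟨t, ht, rfl⟩
    exact zoneShift_mem hy ha hb ht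
  rw [← hinj.ncard_image]
  constructor
  · intro hcard
    have heq := Set.eq_of_subset_of_ncard_le hsub hcard.ge (alcoveInterval_finite _ _)
    by_contra hne
    obtain ⟨z, hz, hzt⟩ := exists_mem_alcoveInterval_not_shift hx hy h1 h2 ha hb (by omega)
    rw [← heq] at hz
    obtain ⟨t, -, ht⟩ := hz
    exact hzt t ht
  · rintro ⟨hA, hB⟩
    congr 1
    apply hsub.antisymm
    intro z hz
    obtain ⟨t, ht, rfl⟩ := exists_zoneShift_eq hx hy hA hB hz
    exact Set.mem_image_of_mem _ ht

/-! ### The Bruhat order in coordinates -/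

/-- `c` assigns to the elements of the Coxeter group the coordinates of their alcoves. -/
structure IsAlcoveCoord {W : Type*} [Group W] {M : CoxeterMatrix (Fin 3)}
    (cs : CoxeterSystem M W) (c : W → ℤ × ℤ) : Prop where
  isAlcove : ∀ w, IsAlcove (c w)
  injective : Function.Injective c
  exists_eq : ∀ z, IsAlcove z → ∃ w, c w = z
  one : c 1 = (-1, -1)
  simple_mul : ∀ i w, c (cs.simple i * w) = affRefl i (if i = 0 then -1 else 0) (c w)

lemma affRefl_conj (j i : Fin 3) (k : ℤ) : ∃ i' k', ∀ z,
    affRefl j (if j = 0 then -1 else 0) (affRefl i k (affRefl j (if j = 0 then -1 else 0) z)) =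
      affRefl i' k' z := by
  fin_cases j <;> fin_cases i
  · refine ⟨0, -2 - k, fun z => ?_⟩
    ext <;> simp [affRefl] <;> ring
  · refine ⟨2, -1 - k, fun z => ?_⟩
    ext <;> simp [affRefl]; ring
  · refine ⟨1, -1 - k, fun z => ?_⟩
    ext <;> simp [affRefl]; ring
  · refine ⟨2, k, fun z => ?_⟩
    ext <;> simp [affRefl]; ring
  · refine ⟨1, -k, fun z => ?_⟩
    ext <;> simp [affRefl]; ring
  · refine ⟨0, k, fun z => ?_⟩
    ext <;> simp [affRefl] <;> ring
  · refine ⟨1, k, fun z => ?_⟩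
    ext <;> simp [affRefl]; ring
  · refine ⟨0, k, fun z => ?_⟩
    ext <;> simp [affRefl] <;> ring
  · refine ⟨2, -k, fun z => ?_⟩
    ext <;> simp [affRefl]; ring

lemma bruhatLE_iff_reflTransGen {B W : Type*} [Group W] {M : CoxeterMatrix B}
    (cs : CoxeterSystem M W) (x y : W) : bruhatLE cs x y ↔ Relation.ReflTransGen
      (fun a b => (∃ t, cs.IsReflection t ∧ b = t * a) ∧ cs.length a < cs.length b) x y := by
  rw [Relation.reflTransGen_iff_eq_or_transGen, bruhatLE, bruhatLT, eq_comm]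

namespace IsAlcoveCoord

variable {W : Type*} [Group W] {M : CoxeterMatrix (Fin 3)} {cs : CoxeterSystem M W}
  {c : W → ℤ × ℤ}

lemma sepTotal_le_length (hc : IsAlcoveCoord cs c) (w : W) :
    sepTotal (c w) ≤ cs.length w := by
  obtain ⟨ω, hω, rfl⟩ := cs.exists_isReduced w
  rw [hω]
  clear hω
  induction ω with
  | nil => simp [hc.one, sepTotal, sepCount, rootVal]
  | cons i ω ih =>
    rw [cs.wordProd_cons, hc.simple_mul, List.length_cons, Nat.cast_succ]
    exact (sepTotal_simple_le (hc.isAlcove _) i).trans (by omega)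

lemma length_le_sepTotal (hc : IsAlcoveCoord cs c) (n : ℕ) :
    ∀ w, sepTotal (c w) ≤ n → cs.length w ≤ n := by
  induction n with
  | zero =>
    intro w hw
    by_contra hne
    have h1 : c w ≠ (-1, -1) := by
      rw [← hc.one]
      rintro h
      rw [hc.injective h] at hne
      simp at hne
    obtain ⟨i, hi⟩ := exists_simple_sepTotal_lt (hc.isAlcove w) h1
    have := sepTotal_nonneg (affRefl i (if i = 0 then -1 else 0) (c w))
    omega
  | succ n ih =>
    intro w hw
    by_cases h1 : c w = (-1, -1)
    · rw [← hc.one] at h1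
      simp [hc.injective h1]
    · obtain ⟨i, hi⟩ := exists_simple_sepTotal_lt (hc.isAlcove w) h1
      rw [← hc.simple_mul] at hi
      have h2 := ih (cs.simple i * w) (by omega)
      rcases cs.length_simple_mul w i with h | h <;> omega

lemma length_eq (hc : IsAlcoveCoord cs c) (w : W) : (cs.length w : ℤ) = sepTotal (c w) := by
  have h1 := hc.sepTotal_le_length w
  have h2 := hc.length_le_sepTotal (sepTotal (c w)).toNat w (Int.self_le_toNat _)
  have := sepTotal_nonneg (c w)
  omega

lemma exists_affRefl_of_isReflection (hc : IsAlcoveCoord cs c) {t : W}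
    (ht : cs.IsReflection t) : ∃ i k, ∀ w, c (t * w) = affRefl i k (c w) := by
  obtain ⟨g, j, rfl⟩ := ht
  induction g using cs.simple_induction_left with
  | one => exact ⟨j, _, fun w => by simpa using hc.simple_mul j w⟩
  | mul_simple_left g i ih =>
    obtain ⟨i₁, k₁, h₁⟩ := ih
    obtain ⟨i₂, k₂, h₂⟩ := affRefl_conj i i₁ k₁
    refine ⟨i₂, k₂, fun w => ?_⟩
    rw [← h₂, ← hc.simple_mul, ← h₁, ← hc.simple_mul]
    simp [mul_assoc]

/-- The affine reflection in `H_{i,k}` is realised by left multiplication by a reflection. -/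
def Realises (cs : CoxeterSystem M W) (c : W → ℤ × ℤ) (i : Fin 3) (k : ℤ) : Prop :=
  ∃ t, cs.IsReflection t ∧ ∀ w, c (t * w) = affRefl i k (c w)

lemma Realises.conj (hc : IsAlcoveCoord cs c) {i : Fin 3} {k : ℤ} (h : Realises cs c i k)
    (j : Fin 3) {i' : Fin 3} {k' : ℤ}
    (h' : ∀ z, affRefl j (if j = 0 then -1 else 0)
      (affRefl i k (affRefl j (if j = 0 then -1 else 0) z)) = affRefl i' k' z) :
    Realises cs c i' k' := by
  obtain ⟨t, ht, hw⟩ := h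
  refine ⟨cs.simple j * t * (cs.simple j)⁻¹, ht.conj _, fun w => ?_⟩
  rw [← h', ← hc.simple_mul, ← hw, ← hc.simple_mul]
  simp [mul_assoc]

lemma realises_rho (hc : IsAlcoveCoord cs c) (k : ℤ) : Realises cs c 0 k := by
  have hs : ∀ j : Fin 3, Realises cs c j (if j = 0 then -1 else 0) := fun j =>
    ⟨cs.simple j, cs.isReflection_simple j, hc.simple_mul j⟩
  have h0 : Realises cs c 0 0 := (hs 1).conj hc 2 fun z => by
    ext <;> simp [affRefl]; ring
  have hneg : ∀ k, Realises cs c 0 k → Realises cs c 0 (-k) := fun k h =>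
    ((h.conj hc 1 (i' := 2) (k' := k) fun z => by ext <;> simp [affRefl]; ring).conj hc 2
      (i' := 2) (k' := -k) fun z => by ext <;> simp [affRefl]; ring).conj hc 1
      fun z => by ext <;> simp [affRefl] <;> ring
  have hstep : ∀ k, Realises cs c 0 k → Realises cs c 0 (-2 - k) := fun k h =>
    h.conj hc 0 fun z => by ext <;> simp [affRefl] <;> ring
  have hnat : ∀ n : ℕ, Realises cs c 0 n ∧ Realises cs c 0 (n + 1) := by
    intro n
    induction n with
    | zero => exact ⟨by simpa using h0, by simpa using hneg _ (hs 0)⟩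
    | succ n ih =>
      refine ⟨by simpa using ih.2, ?_⟩
      have := hneg _ (hstep _ ih.1)
      have he : (-(-2 - (n : ℤ))) = ((n + 1 : ℕ) : ℤ) + 1 := by push_cast; ring
      rwa [he] at this
  rcases Int.eq_nat_or_neg k with ⟨n, rfl | rfl⟩
  · exact (hnat n).1
  · exact hneg _ (hnat n).1

lemma realises (hc : IsAlcoveCoord cs c) (i : Fin 3) (k : ℤ) : Realises cs c i k := by
  have h := hc.realises_rho k
  fin_cases i
  · exact h
  · exact h.conj hc 2 fun z => by ext <;> simp [affRefl]; ring
  · exact h.conj hc 1 fun z => by ext <;> simp [affRefl]; ring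

lemma exists_ascends_of_step (hc : IsAlcoveCoord cs c) {a b : W}
    (h : (∃ t, cs.IsReflection t ∧ b = t * a) ∧ cs.length a < cs.length b) :
    ∃ i k, Ascends i k (c a) ∧ c b = affRefl i k (c a) := by
  obtain ⟨⟨t, ht, rfl⟩, hlen⟩ := h
  obtain ⟨i, k, hik⟩ := hc.exists_affRefl_of_isReflection ht
  refine ⟨i, k, ?_, hik a⟩
  rcases ascends_or_ascends_affRefl (hc.isAlcove a) i k with h | h
  · exact h
  · have h1 := sepTotal_lt_of_ascends ((hc.isAlcove a).reflect i k) h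
    rw [affRefl_affRefl, ← hik, ← hc.length_eq, ← hc.length_eq] at h1
    omega

lemma step_of_ascends (hc : IsAlcoveCoord cs c) {a b : W} {i : Fin 3} {k : ℤ}
    (h : Ascends i k (c a)) (hb : c b = affRefl i k (c a)) :
    (∃ t, cs.IsReflection t ∧ b = t * a) ∧ cs.length a < cs.length b := by
  obtain ⟨t, ht, hw⟩ := hc.realises i k
  refine ⟨⟨t, ht, hc.injective (by rw [hb, hw])⟩, ?_⟩
  have := sepTotal_lt_of_ascends (hc.isAlcove a) h
  rw [← hb, ← hc.length_eq, ← hc.length_eq] at this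
  omega

theorem bruhatLE_dom_iff (hc : IsAlcoveCoord cs c) {y : W} (hy : IsDom (c y)) (z : W) :
    bruhatLE cs z y ↔ BelowDom (c y) (c z) := by
  rw [bruhatLE_iff_reflTransGen]
  constructor
  · intro h
    induction h using Relation.ReflTransGen.head_induction_on with
    | refl => exact BelowDom.self hy
    | head h _ ih =>
      obtain ⟨i, k, hik, he⟩ := hc.exists_ascends_of_step h
      rw [he] at ih
      exact ih.of_ascends (hc.isAlcove _) hik
  · have hbound : ∀ z, BelowDom (c y) (c z) →
        sepTotal (c z) ≤ 10 * ((c y).1 + (c y).2) + 10 := by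
      intro z h
      simp only [BelowDom, sepTotal, sepCount, rootVal] at *
      omega
    suffices H : ∀ n : ℕ, ∀ z, 10 * ((c y).1 + (c y).2) + 10 - sepTotal (c z) ≤ n →
        BelowDom (c y) (c z) → Relation.ReflTransGen (fun a b =>
          (∃ t, cs.IsReflection t ∧ b = t * a) ∧ cs.length a < cs.length b) z y from
      H _ z (Int.self_le_toNat _)
    intro n
    induction n with
    | zero =>
      intro z hn hb
      by_cases hzy : z = y
      · rw [hzy]
      obtain ⟨i, k, hik, hb'⟩ := hb.exists_ascends (hc.isAlcove y) (hc.isAlcove z) hy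
        (hc.injective.ne hzy)
      obtain ⟨w, hw⟩ := hc.exists_eq _ ((hc.isAlcove z).reflect i k)
      have h1 := sepTotal_lt_of_ascends (hc.isAlcove z) hik
      rw [← hw] at hb' h1
      have := hbound w hb'
      omega
    | succ n ih =>
      intro z hn hb
      by_cases hzy : z = y
      · rw [hzy]
      obtain ⟨i, k, hik, hb'⟩ := hb.exists_ascends (hc.isAlcove y) (hc.isAlcove z) hy
        (hc.injective.ne hzy)
      obtain ⟨w, hw⟩ := hc.exists_eq _ ((hc.isAlcove z).reflect i k)
      have h1 := sepTotal_lt_of_ascends (hc.isAlcove z) hik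
      have hs := hc.step_of_ascends hik hw
      rw [← hw] at hb' h1
      exact .head hs (ih w (by omega) hb')

theorem dom_bruhatLE_iff (hc : IsAlcoveCoord cs c) {x : W} (hx : IsDom (c x)) (z : W) :
    bruhatLE cs x z ↔ AboveDom (c x) (c z) := by
  rw [bruhatLE_iff_reflTransGen]
  constructor
  · intro h
    induction h with
    | refl => exact AboveDom.self hx
    | tail _ h ih =>
      obtain ⟨i, k, hik, he⟩ := hc.exists_ascends_of_step h
      rw [he]
      exact ih.reflect hx (hc.isAlcove _) hik
  · induction hn : cs.length z using Nat.strong_induction_on generalizing z with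
    | _ n ih =>
      intro hb
      by_cases hzx : z = x
      · rw [hzx]
      obtain ⟨i, k, hik, hb'⟩ := hb.exists_ascends (hc.isAlcove x) (hc.isAlcove z) hx
        (hc.injective.ne hzx)
      obtain ⟨w, hw⟩ := hc.exists_eq _ ((hc.isAlcove z).reflect i k)
      rw [← hw] at hb' hik
      have hs := hc.step_of_ascends hik (b := z) (by rw [hw, affRefl_affRefl])
      exact .tail (ih _ (hn ▸ hs.2) w rfl hb') hs

lemma ncard_Iset (hc : IsAlcoveCoord cs c) {x y : W} (hx : IsDom (c x)) (hy : IsDom (c y)) :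
    (Iset cs x y).ncard = (alcoveInterval (c x) (c y)).ncard := by
  rw [← Set.ncard_image_of_injective _ hc.injective]
  congr 1
  ext z
  constructor
  · rintro ⟨w, hw, rfl⟩
    exact ⟨hc.isAlcove w, (hc.dom_bruhatLE_iff hx w).1 hw.1, (hc.bruhatLE_dom_iff hy w).1 hw.2⟩
  · rintro ⟨hz, h1, h2⟩
    obtain ⟨w, rfl⟩ := hc.exists_eq z hz
    exact ⟨w, ⟨(hc.dom_bruhatLE_iff hx w).2 h1, (hc.bruhatLE_dom_iff hy w).2 h2⟩, rfl⟩

end IsAlcoveCoord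

/-! ### Coordinates of barycenters -/

/-- The point of the plane with integer coordinates `3 v` in the basis of simple roots. -/
def ofCoord (z : ℤ × ℤ) : E2 := ((z.1 : ℝ) / 3, (z.2 : ℝ) / 3)

lemma ofCoord_injective : Function.Injective ofCoord := by
  rintro ⟨u, v⟩ ⟨u', v'⟩ h
  simp only [ofCoord, Prod.mk.injEq] at h
  ext
  · have : (u : ℝ) = u' := by linarith [h.1]
    exact_mod_cast this
  · have : (v : ℝ) = v' := by linarith [h.2]
    exact_mod_cast this

lemma ofCoord_add (z z' : ℤ × ℤ) : ofCoord (z + z') = ofCoord z + ofCoord z' := by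
  ext <;> simp [ofCoord] <;> ring

lemma ofCoord_wtCoord (a b : ℤ) :
    ofCoord (wtCoord a b) = (a : ℝ) • fw1 + (b : ℝ) • fw2 := by
  ext <;> simp [ofCoord, wtCoord, fw1, fw2] <;> ring

lemma reflE_ofCoord (i : Fin 3) (k : ℤ) (z : ℤ × ℤ) :
    reflE (match i with | 0 => rho2 | 1 => a1 | 2 => a2) k (ofCoord z) =
      ofCoord (affRefl i k z) := by
  fin_cases i <;> ext <;> simp [reflE, B2, ofCoord, affRefl, rho2, a1, a2] <;> ring

lemma exists_coord {W : Type*} [Group W] {M : CoxeterMatrix (Fin 3)}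
    (cs : CoxeterSystem M W) (act : W →* Equiv.Perm E2)
    (h0 : ∀ v, act (cs.simple 0) v = reflE rho2 (-1) v)
    (h1 : ∀ v, act (cs.simple 1) v = reflE a1 0 v)
    (h2 : ∀ v, act (cs.simple 2) v = reflE a2 0 v)
    (hcen : Function.Injective (cen act)) (Wadd : W → E2 → W)
    (hWadd : ∀ z : W, ∀ v ∈ wLat, cen act (Wadd z v) = cen act z + v) :
    ∃ c : W → ℤ × ℤ, IsAlcoveCoord cs c ∧ ∀ w, cen act w = ofCoord (c w) := by
  have hone : cen act 1 = ofCoord (-1, -1) := by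
    ext <;> simp [cen, ofCoord, rho2] <;> ring
  have hmul : ∀ i w z, cen act w = ofCoord z →
      cen act (cs.simple i * w) = ofCoord (affRefl i (if i = 0 then -1 else 0) z) := by
    intro i w z h
    have hs : cen act (cs.simple i * w) = act (cs.simple i) (cen act w) := by simp [cen]
    rw [hs, h, ← reflE_ofCoord]
    fin_cases i
    · simpa using h0 _
    · simpa using h1 _
    · simpa using h2 _
  have hex : ∀ w, ∃ z, IsAlcove z ∧ cen act w = ofCoord z := by
    intro w
    induction w using cs.simple_induction_left with
    | one => exact ⟨(-1, -1), by simp [IsAlcove], hone⟩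
    | mul_simple_left w i ih =>
      obtain ⟨z, hz, h⟩ := ih
      exact ⟨_, hz.reflect _ _, hmul i w z h⟩
  choose c hc hcc using hex
  have hc1 : c 1 = (-1, -1) := ofCoord_injective (by rw [← hcc, hone])
  have hcm : ∀ i w, c (cs.simple i * w) = affRefl i (if i = 0 then -1 else 0) (c w) :=
    fun i w => ofCoord_injective (by rw [← hcc, hmul i w _ (hcc w)])
  have hadd : ∀ (w) (a b : ℤ), c (Wadd w ((a : ℝ) • fw1 + (b : ℝ) • fw2)) = c w + wtCoord a b := by
    intro w a b
    apply ofCoord_injective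
    rw [← hcc, hWadd w _ ⟨a, b, rfl⟩, hcc, ofCoord_add, ofCoord_wtCoord]
  have hs1 : c (cs.simple 1) = (0, -1) := by
    simpa [affRefl, hc1] using hcm 1 1
  refine ⟨c, ⟨hc, ?_, ?_, hc1, hcm⟩, hcc⟩
  · intro w w' h
    exact hcen (by rw [hcc, hcc, h])
  · rintro ⟨u, v⟩ hz
    simp only [IsAlcove] at hz
    by_cases h : (u + v) % 3 = 1
    · obtain ⟨k, hk⟩ : (3 : ℤ) ∣ u + v + 2 := by omega
      refine ⟨_, (hadd 1 (u + 1 - k) (v + 1 - k)).trans ?_⟩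
      rw [hc1]
      ext <;> simp [wtCoord] <;> linarith
    · obtain ⟨k, hk⟩ : (3 : ℤ) ∣ u + v + 1 := by omega
      refine ⟨_, (hadd (cs.simple 1) (u - k) (v + 1 - k)).trans ?_⟩
      rw [hs1]
      ext <;> simp [wtCoord] <;> linarith

/-! ### The polygons -/

lemma mem_Pgn_iff {W : Type*} [Group W] {act : W →* Equiv.Perm E2} {x y : W}
    {p q : ℤ × ℤ} (hx : cen act x = ofCoord p) (hy : cen act y = ofCoord q) (v : E2) :
    v ∈ Pgn act x y ↔ (-1 ≤ 2 * v.1 - v.2 ∧ -1 ≤ 2 * v.2 - v.1 ∧ -1 ≤ v.1 + v.2) ∧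
      ((p.1 : ℝ) ≤ 3 * v.1 ∧ (p.2 : ℝ) ≤ 3 * v.2) ∧
      (3 * v.1 ≤ (q.1 : ℝ) ∧ 3 * v.2 ≤ (q.2 : ℝ)) := by
  obtain ⟨v1, v2⟩ := v
  have hF : (v1, v2) ∈ Fid ↔ -1 ≤ 2 * v1 - v2 ∧ -1 ≤ 2 * v2 - v1 ∧ -1 ≤ v1 + v2 := by
    simp only [Fid, B2, a1, a2, rho2, Set.mem_ofPred_eq]
    ring_nf
  have hK : ∀ k : E2, k ∈ coneK ↔ 0 ≤ k.1 ∧ 0 ≤ k.2 := by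
    rintro ⟨k1, k2⟩
    simp only [coneK, a1, a2, Set.mem_ofPred_eq]
    constructor
    · rintro ⟨a, b, ha, hb, h⟩
      simp only [Prod.smul_mk, Prod.mk_add_mk, Prod.mk.injEq, smul_eq_mul] at h
      constructor <;> linarith
    · rintro ⟨h1, h2⟩
      exact ⟨k1, k2, h1, h2, by simp⟩
  have hadd : (∃ k ∈ coneK, (v1, v2) = ofCoord p + k) ↔
      (p.1 : ℝ) ≤ 3 * v1 ∧ (p.2 : ℝ) ≤ 3 * v2 := by
    constructor
    · rintro ⟨k, hk, h⟩
      rw [hK] at hk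
      simp only [ofCoord, Prod.ext_iff, Prod.fst_add, Prod.snd_add] at h
      constructor <;> linarith
    · rintro ⟨h1, h2⟩
      refine ⟨(v1, v2) - ofCoord p, (hK _).2 ⟨?_, ?_⟩, by simp⟩ <;>
      simp only [ofCoord, Prod.fst_sub, Prod.snd_sub] <;> linarith
  have hsub : (∃ k ∈ coneK, (v1, v2) = ofCoord q - k) ↔
      3 * v1 ≤ (q.1 : ℝ) ∧ 3 * v2 ≤ (q.2 : ℝ) := by
    constructor
    · rintro ⟨k, hk, h⟩
      rw [hK] at hk
      simp only [ofCoord, Prod.ext_iff, Prod.fst_sub, Prod.snd_sub] at h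
      constructor <;> linarith
    · rintro ⟨h1, h2⟩
      refine ⟨ofCoord q - (v1, v2), (hK _).2 ⟨?_, ?_⟩, by simp⟩ <;>
      simp only [ofCoord, Prod.fst_sub, Prod.snd_sub] <;> linarith
  simp only [Pgn, Set.mem_ofPred_eq, hx, hy, hF, hadd, hsub]

theorem image_Pgn_eq_iff {W : Type*} [Group W] {act : W →* Equiv.Perm E2} {x y x' y' : W}
    {p q : ℤ × ℤ} (hp : IsDom p) (hq : IsDom q) (h1 : p.1 ≤ q.1) (h2 : p.2 ≤ q.2)
    {a b : ℤ} (ha : 0 ≤ a) (hb : 0 ≤ b)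
    (hx : cen act x = ofCoord p) (hy : cen act y = ofCoord q)
    (hx' : cen act x' = ofCoord (p + wtCoord a b))
    (hy' : cen act y' = ofCoord (q + wtCoord a b)) :
    (fun v => v + ofCoord (wtCoord a b)) '' Pgn act x y = Pgn act x' y' ↔
      (a = 0 ∨ -3 ≤ 2 * p.1 - q.2) ∧ (b = 0 ∨ -3 ≤ 2 * p.2 - q.1) := by
  obtain ⟨p1, p2⟩ := p
  obtain ⟨q1, q2⟩ := q
  have haR : (0 : ℝ) ≤ a := by exact_mod_cast ha
  have hbR : (0 : ℝ) ≤ b := by exact_mod_cast hb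
  have h1R : (p1 : ℝ) ≤ q1 := by exact_mod_cast h1
  have h2R : (p2 : ℝ) ≤ q2 := by exact_mod_cast h2
  have hp1 : (0 : ℝ) < 2 * p1 - p2 := by exact_mod_cast hp.1
  have hp2 : (0 : ℝ) < 2 * p2 - p1 := by exact_mod_cast hp.2
  have hq1 : (0 : ℝ) < 2 * q1 - q2 := by exact_mod_cast hq.1
  have hq2 : (0 : ℝ) < 2 * q2 - q1 := by exact_mod_cast hq.2
  constructor
  · intro heq
    constructor <;> by_contra! hne
    · obtain ⟨hane, hlt⟩ := hne
      have ha1 : (1 : ℝ) ≤ a := by exact_mod_cast (by omega : 1 ≤ a)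
      have hltR : 2 * (p1 : ℝ) - q2 ≤ -4 := by exact_mod_cast (by simp only at hlt; omega)
      have hmem : (((p1 : ℝ) + 2 * a + b) / 3, (2 * (p1 : ℝ) + a + 2 * b + 4) / 3) ∈
          Pgn act x' y' := by
        rw [mem_Pgn_iff hx' hy']
        simp only [wtCoord, Prod.mk_add_mk]
        push_cast
        refine ⟨⟨?_, ?_, ?_⟩, ⟨?_, ?_⟩, ?_, ?_⟩ <;> linarith
      rw [← heq] at hmem
      obtain ⟨v, hv, h⟩ := hmem
      rw [mem_Pgn_iff hx hy] at hv
      simp only [ofCoord, wtCoord, Prod.ext_iff, Prod.fst_add, Prod.snd_add] at h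
      push_cast at h
      linarith [hv.1.1]
    · obtain ⟨hbne, hlt⟩ := hne
      have hb1 : (1 : ℝ) ≤ b := by exact_mod_cast (by omega : 1 ≤ b)
      have hltR : 2 * (p2 : ℝ) - q1 ≤ -4 := by exact_mod_cast (by simp only at hlt; omega)
      have hmem : ((2 * (p2 : ℝ) + 2 * a + b + 4) / 3, ((p2 : ℝ) + a + 2 * b) / 3) ∈
          Pgn act x' y' := by
        rw [mem_Pgn_iff hx' hy']
        simp only [wtCoord, Prod.mk_add_mk]
        push_cast
        refine ⟨⟨?_, ?_, ?_⟩, ⟨?_, ?_⟩, ?_, ?_⟩ <;> linarith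
      rw [← heq] at hmem
      obtain ⟨v, hv, h⟩ := hmem
      rw [mem_Pgn_iff hx hy] at hv
      simp only [ofCoord, wtCoord, Prod.ext_iff, Prod.fst_add, Prod.snd_add] at h
      push_cast at h
      linarith [hv.1.2.1]
  · rintro ⟨hA, hB⟩
    have hAR : (a : ℝ) = 0 ∨ (-3 : ℝ) ≤ 2 * p1 - q2 := by exact_mod_cast hA
    have hBR : (b : ℝ) = 0 ∨ (-3 : ℝ) ≤ 2 * p2 - q1 := by exact_mod_cast hB
    ext ⟨v1, v2⟩
    simp only [Set.mem_image]
    constructor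
    · rintro ⟨w, hw, h⟩
      rw [mem_Pgn_iff hx hy] at hw
      rw [mem_Pgn_iff hx' hy']
      simp only [ofCoord, wtCoord, Prod.ext_iff, Prod.fst_add, Prod.snd_add] at h hw ⊢
      push_cast at h ⊢
      refine ⟨⟨?_, ?_, ?_⟩, ⟨?_, ?_⟩, ?_, ?_⟩ <;> linarith
    · intro hv
      rw [mem_Pgn_iff hx' hy'] at hv
      refine ⟨(v1, v2) - ofCoord (wtCoord a b), ?_, by simp⟩
      rw [mem_Pgn_iff hx hy]
      simp only [ofCoord, wtCoord, Prod.mk_add_mk, Prod.mk_sub_mk] at hv ⊢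
      push_cast at hv ⊢
      obtain ⟨⟨e1, e2, e3⟩, ⟨e4, e5⟩, e6, e7⟩ := hv
      refine ⟨⟨?_, ?_, ?_⟩, ⟨?_, ?_⟩, ?_, ?_⟩
      · rcases hAR with h | h <;> linarith
      · rcases hBR with h | h <;> linarith
      all_goals linarith

/-- `[x,y]` and `[x+λ, y+λ]` have the same cardinality iff the polygon
`Pgn_{x,y}` translates onto `Pgn_{x+λ, y+λ}`. -/
theorem statement10
    {W : Type*} [Group W] {M : CoxeterMatrix (Fin 3)} (cs : CoxeterSystem M W)
    (hM : ∀ i j : Fin 3, M i j = if i = j then 1 else 3)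
    (act : W →* Equiv.Perm E2)
    (h0 : ∀ v, act (cs.simple 0) v = reflE rho2 (-1) v)
    (h1 : ∀ v, act (cs.simple 1) v = reflE a1 0 v)
    (h2 : ∀ v, act (cs.simple 2) v = reflE a2 0 v)
    (hcen : Function.Injective (cen act))
    (th ths : ℕ → ℕ → W)
    (hth : ∀ m n : ℕ, cen act (th m n) =
      cen act (cs.simple 1 * cs.simple 2 * cs.simple 1) + (m : ℝ) • fw1 + (n : ℝ) • fw2)
    (hths : ∀ m n : ℕ, cen act (ths m n) =
      cen act 1 + ((m : ℝ) + 1) • fw1 + ((n : ℝ) + 1) • fw2)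
    (Wadd : W → E2 → W)
    (hWadd : ∀ (z : W), ∀ v ∈ wLat, cen act (Wadd z v) = cen act z + v)
    (x y : W) (hx : x ∈ Dset th ths) (hy : y ∈ Dset th ths) (hxy : bruhatLE cs x y)
    (lam : E2) (hlam : ∃ a b : ℕ, lam = (a : ℝ) • fw1 + (b : ℝ) • fw2) :
    (Iset cs x y).ncard = (Iset cs (Wadd x lam) (Wadd y lam)).ncard ↔
      (fun v => v + lam) '' Pgn act x y = Pgn act (Wadd x lam) (Wadd y lam) := by
  obtain ⟨c, hc, hcc⟩ := exists_coord cs act h0 h1 h2 hcen Wadd hWadd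
  obtain ⟨a, b, rfl⟩ := hlam
  have hw0 : c (cs.simple 1 * cs.simple 2 * cs.simple 1) = (1, 1) := by
    have h := hc.simple_mul 1 (cs.simple 2 * (cs.simple 1 * 1))
    rw [hc.simple_mul 2, hc.simple_mul 1 1, hc.one] at h
    simpa [affRefl, mul_assoc] using h
  have hdom : ∀ w ∈ Dset th ths, IsDom (c w) := by
    rintro w (⟨m, n, rfl⟩ | ⟨m, n, rfl⟩)
    · have h : c (th m n) = (1, 1) + wtCoord m n := ofCoord_injective (by
        rw [← hcc, hth, ofCoord_add, ofCoord_wtCoord, hcc, hw0, add_assoc]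
        push_cast
        rfl)
      rw [h]
      simp only [IsDom, wtCoord, Prod.mk_add_mk]
      omega
    · have h : c (ths m n) = (-1, -1) + wtCoord (m + 1) (n + 1) := ofCoord_injective (by
        rw [← hcc, hths, ofCoord_add, ofCoord_wtCoord, hcc, hc.one, add_assoc]
        push_cast
        rfl)
      rw [h]
      simp only [IsDom, wtCoord, Prod.mk_add_mk]
      omega
  have hadd : ∀ w, c (Wadd w ((a : ℝ) • fw1 + (b : ℝ) • fw2)) = c w + wtCoord a b := by
    intro w
    apply ofCoord_injective
    rw [← hcc, hWadd w _ ⟨a, b, by push_cast; rfl⟩, hcc, ofCoord_add, ofCoord_wtCoord]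
    push_cast
    rfl
  have hdx := hdom x hx
  have hdy := hdom y hy
  have hle := (hc.bruhatLE_dom_iff hdy x).1 hxy
  have ha : (0 : ℤ) ≤ a := Int.natCast_nonneg a
  have hb : (0 : ℤ) ≤ b := Int.natCast_nonneg b
  rw [hc.ncard_Iset hdx hdy, hc.ncard_Iset (by rw [hadd]; exact hdx.add_wtCoord ha hb)
    (by rw [hadd]; exact hdy.add_wtCoord ha hb), hadd, hadd,
    ncard_alcoveInterval_eq_iff hdx hdy hle.1.1 hle.2.1 ha hb,
    ← image_Pgn_eq_iff hdx hdy hle.1.1 hle.2.1 ha hb (hcc x) (hcc y)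
      ((hcc _).trans (by rw [hadd])) ((hcc _).trans (by rw [hadd])), ofCoord_wtCoord]
  push_cast
  rfl
end
end

section
/- Let x ≤ y be dominant elements of W such that the interval [x,y] is thick. Then: (1) there exist dominant elements x0, y0 ∈ D with x = x0 + ρ and y = y0 + ρ, and moreover x + ρ ∈ [x,y] and y − ρ ∈ [x,y]; (2) the interval [x,y] is full, i.e. every Bruhat cover of x and every Bruhat cocover of y belongs to [x,y]. -/
noncomputable section

open scoped RealInnerProductSpace

/-- Integer coordinates for the alcoves: `(A w, B w)` are the coefficients of three times the
barycentre of the alcove of `w` in the basis of simple roots. -/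
structure AlcoveCoords {W : Type*} [Group W] {M : CoxeterMatrix (Fin 3)}
    (cs : CoxeterSystem M W) where
  A : W → ℤ
  B : W → ℤ
  ext : ∀ u v, A u = A v → B u = B v → u = v
  A_one : A 1 = -1
  B_one : B 1 = -1
  A_s0 : ∀ w, A (cs.simple 0 * w) = -B w - 3
  B_s0 : ∀ w, B (cs.simple 0 * w) = -A w - 3
  A_s1 : ∀ w, A (cs.simple 1 * w) = B w - A w
  B_s1 : ∀ w, B (cs.simple 1 * w) = B w
  A_s2 : ∀ w, A (cs.simple 2 * w) = A w
  B_s2 : ∀ w, B (cs.simple 2 * w) = A w - B w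

/-- The number of reflection lines separating the fundamental alcove from an alcove at which
`α₁`, `α₂`, `ρ` have integer parts `i`, `j`, `i + j + e - 1`. -/
def lineCount (i j e : ℤ) : ℕ := (i + 1).natAbs + (j + 1).natAbs + (i + j + e).natAbs

/-- One upward reflection step; its transitive closure is the strict Bruhat order. -/
def BruhatStep {B : Type*} {W : Type*} [Group W] {M : CoxeterMatrix B}
    (cs : CoxeterSystem M W) (a b : W) : Prop :=
  (∃ t, cs.IsReflection t ∧ b = t * a) ∧ cs.length a < cs.length b

section Bruhat

variable {B : Type*} {W : Type*} [Group W] {M : CoxeterMatrix B} {cs : CoxeterSystem M W}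

theorem BruhatStep.le {x y : W} (h : BruhatStep cs x y) : bruhatLE cs x y :=
  Or.inr (Relation.TransGen.single h)

theorem bruhatLE.trans {x y z : W} (h : bruhatLE cs x y) (h' : bruhatLE cs y z) :
    bruhatLE cs x z := by
  rcases h with rfl | h
  · exact h'
  · rcases h' with rfl | h'
    · exact Or.inr h
    · exact Or.inr (Relation.TransGen.trans h h')

theorem length_lt_of_bruhatLT {x y : W} (h : bruhatLT cs x y) : cs.length x < cs.length y := by
  induction h with
  | single h => exact h.2
  | tail _ h ih => exact ih.trans h.2

theorem bruhatStep_of_bruhatLT {x y : W} (h : bruhatLT cs x y)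
    (hl : cs.length y = cs.length x + 1) : BruhatStep cs x y := by
  cases h with
  | single h => exact h
  | tail h' h =>
    have h₁ := length_lt_of_bruhatLT h'
    have h₂ := h.2
    omega

end Bruhat

namespace AlcoveCoords

variable {W : Type*} [Group W] {M : CoxeterMatrix (Fin 3)} {cs : CoxeterSystem M W}
  (C : AlcoveCoords cs)

/-- `t` acts on coordinates as the reflection `s_{α₁,k}`, `s_{α₂,k}` or `s_{ρ,k}`. -/
def ActsAsReflection (t : W) : Prop :=
  ∃ k : ℤ, (∀ w, C.A (t * w) = C.B w - C.A w + 3 * k ∧ C.B (t * w) = C.B w) ∨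
    (∀ w, C.A (t * w) = C.A w ∧ C.B (t * w) = C.A w - C.B w + 3 * k) ∨
    (∀ w, C.A (t * w) = 3 * k - C.B w ∧ C.B (t * w) = 3 * k - C.A w)

/-- The barycentre of `w` takes the values `i + e/3` on `α₁` and `j + e/3` on `α₂`. -/
def Position (w : W) (i j e : ℤ) : Prop :=
  (e = 1 ∨ e = 2) ∧ C.A w = 2 * i + j + e ∧ C.B w = i + 2 * j + e

variable {C} in
theorem Position.alpha₁ {w w' : W} {i j e : ℤ} (h : C.Position w i j e) (k : ℤ)
    (hA : C.A w' = C.B w - C.A w + 3 * k) (hB : C.B w' = C.B w) :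
    C.Position w' (2 * k - 1 - i) (i + j - k + e - 1) (3 - e) := by
  obtain ⟨he, ha, hb⟩ := h
  exact ⟨by omega, by omega, by omega⟩

variable {C} in
theorem Position.alpha₂ {w w' : W} {i j e : ℤ} (h : C.Position w i j e) (k : ℤ)
    (hA : C.A w' = C.A w) (hB : C.B w' = C.A w - C.B w + 3 * k) :
    C.Position w' (i + j - k + e - 1) (2 * k - 1 - j) (3 - e) := by
  obtain ⟨he, ha, hb⟩ := h
  exact ⟨by omega, by omega, by omega⟩

variable {C} in
theorem Position.rho {w w' : W} {i j e : ℤ} (h : C.Position w i j e) (k : ℤ)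
    (hA : C.A w' = 3 * k - C.B w) (hB : C.B w' = 3 * k - C.A w) :
    C.Position w' (k - 1 - j) (k - 1 - i) (3 - e) := by
  obtain ⟨he, ha, hb⟩ := h
  exact ⟨by omega, by omega, by omega⟩

theorem position_one : C.Position 1 (-1) (-1) 2 := by
  simp [Position, C.A_one, C.B_one]

theorem Position.s0 {w : W} {i j e : ℤ} (h : C.Position w i j e) :
    C.Position (cs.simple 0 * w) (-2 - j) (-2 - i) (3 - e) :=
  h.rho (-1) (by rw [C.A_s0]; ring) (by rw [C.B_s0]; ring)

theorem Position.s1 {w : W} {i j e : ℤ} (h : C.Position w i j e) :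
    C.Position (cs.simple 1 * w) (-1 - i) (i + j + e - 1) (3 - e) := by
  simpa using h.alpha₁ 0 (by rw [C.A_s1]; ring) (by rw [C.B_s1])

theorem Position.s2 {w : W} {i j e : ℤ} (h : C.Position w i j e) :
    C.Position (cs.simple 2 * w) (i + j + e - 1) (-1 - j) (3 - e) := by
  simpa using h.alpha₂ 0 (by rw [C.A_s2]) (by rw [C.B_s2]; ring)

theorem exists_position (w : W) : ∃ i j e, C.Position w i j e := by
  induction w using cs.simple_induction_left with
  | one => exact ⟨_, _, _, C.position_one⟩
  | mul_simple_left w n ih =>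
    obtain ⟨i, j, e, h⟩ := ih
    fin_cases n
    · exact ⟨_, _, _, h.s0⟩
    · exact ⟨_, _, _, h.s1⟩
    · exact ⟨_, _, _, h.s2⟩

variable {C} in
theorem Position.lineCount_eq {w : W} {i j e i' j' e' : ℤ} (h : C.Position w i j e)
    (h' : C.Position w i' j' e') : lineCount i j e = lineCount i' j' e' := by
  obtain ⟨he, ha, hb⟩ := h
  obtain ⟨he', ha', hb'⟩ := h'
  obtain rfl : i = i' := by omega
  obtain rfl : j = j' := by omega
  obtain rfl : e = e' := by omega
  rfl

theorem ActsAsReflection.conj_simple {t : W} (h : C.ActsAsReflection t) (i : Fin 3) :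
    C.ActsAsReflection (cs.simple i * t * cs.simple i) := by
  obtain ⟨k, h | h | h⟩ := h <;> fin_cases i <;>
    simp only [Fin.zero_eta, Fin.mk_one, Fin.reduceFinMk]
  · refine ⟨-1 - k, Or.inr (Or.inl fun w => ?_)⟩
    simp only [mul_assoc, C.A_s0, C.B_s0, h]; omega
  · refine ⟨-k, Or.inl fun w => ?_⟩
    simp only [mul_assoc, C.A_s1, C.B_s1, h, and_true]; omega
  · refine ⟨k, Or.inr (Or.inr fun w => ?_)⟩
    simp only [mul_assoc, C.A_s2, C.B_s2, h]; omega
  · refine ⟨-1 - k, Or.inl fun w => ?_⟩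
    simp only [mul_assoc, C.A_s0, C.B_s0, h]; omega
  · refine ⟨k, Or.inr (Or.inr fun w => ?_)⟩
    simp only [mul_assoc, C.A_s1, C.B_s1, h]; omega
  · refine ⟨-k, Or.inr (Or.inl fun w => ?_)⟩
    simp only [mul_assoc, C.A_s2, C.B_s2, h, true_and]; omega
  · refine ⟨-2 - k, Or.inr (Or.inr fun w => ?_)⟩
    simp only [mul_assoc, C.A_s0, C.B_s0, h]; omega
  · refine ⟨k, Or.inr (Or.inl fun w => ?_)⟩
    simp only [mul_assoc, C.A_s1, C.B_s1, h]; omega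
  · refine ⟨k, Or.inl fun w => ?_⟩
    simp only [mul_assoc, C.A_s2, C.B_s2, h]; omega

theorem actsAsReflection_of_isReflection {t : W} (ht : cs.IsReflection t) :
    C.ActsAsReflection t := by
  obtain ⟨w, i, rfl⟩ := ht
  induction w using cs.simple_induction_left with
  | one =>
    simp only [one_mul, inv_one, mul_one]
    fin_cases i <;> simp only [Fin.zero_eta, Fin.mk_one, Fin.reduceFinMk]
    · exact ⟨-1, Or.inr (Or.inr fun w => by rw [C.A_s0, C.B_s0]; omega)⟩
    · exact ⟨0, Or.inl fun w => by rw [C.A_s1, C.B_s1]; omega⟩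
    · exact ⟨0, Or.inr (Or.inl fun w => by rw [C.A_s2, C.B_s2]; omega)⟩
  | mul_simple_left w j ih => simpa [mul_assoc] using ih.conj_simple C j

/-- Every `s_{ρ,k}` is the action of a reflection of `W`. -/
theorem exists_isReflection_rho (k : ℤ) : ∃ t, cs.IsReflection t ∧
    ∀ w, C.A (t * w) = 3 * k - C.B w ∧ C.B (t * w) = 3 * k - C.A w := by
  have h₀ : ∃ t, cs.IsReflection t ∧
      ∀ w, C.A (t * w) = 3 * 0 - C.B w ∧ C.B (t * w) = 3 * 0 - C.A w := by
    refine ⟨cs.simple 1 * cs.simple 2 * (cs.simple 1)⁻¹, ⟨_, _, rfl⟩, fun w => ?_⟩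
    simp only [cs.inv_simple, mul_assoc, C.A_s1, C.B_s1, C.A_s2, C.B_s2]; omega
  obtain ⟨r, hr, hrw⟩ := h₀
  have down : ∀ k : ℤ, (∃ t, cs.IsReflection t ∧
      ∀ w, C.A (t * w) = 3 * k - C.B w ∧ C.B (t * w) = 3 * k - C.A w) →
      ∃ t, cs.IsReflection t ∧
      ∀ w, C.A (t * w) = 3 * (-2 - k) - C.B w ∧ C.B (t * w) = 3 * (-2 - k) - C.A w := by
    rintro k ⟨t, ht, h⟩
    refine ⟨_, ht.conj (cs.simple 0), fun w => ?_⟩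
    simp only [cs.inv_simple, mul_assoc, C.A_s0, C.B_s0, h]; omega
  have neg : ∀ k : ℤ, (∃ t, cs.IsReflection t ∧
      ∀ w, C.A (t * w) = 3 * k - C.B w ∧ C.B (t * w) = 3 * k - C.A w) →
      ∃ t, cs.IsReflection t ∧
      ∀ w, C.A (t * w) = 3 * (-k) - C.B w ∧ C.B (t * w) = 3 * (-k) - C.A w := by
    rintro k ⟨t, ht, h⟩
    refine ⟨_, ht.conj r, fun w => ?_⟩
    have hi : r⁻¹ = r := hr.inv
    simp only [hi, mul_assoc, hrw, h]; omega
  have key : ∀ n : ℕ, (∃ t, cs.IsReflection t ∧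
      ∀ w, C.A (t * w) = 3 * (n : ℤ) - C.B w ∧ C.B (t * w) = 3 * (n : ℤ) - C.A w) := by
    intro n
    induction n using Nat.strong_induction_on with
    | _ n ih =>
      match n with
      | 0 => exact ⟨r, hr, by simpa using hrw⟩
      | 1 =>
        refine neg (-1) ⟨cs.simple 0, cs.isReflection_simple 0, fun w => ?_⟩
        rw [C.A_s0, C.B_s0]; omega
      | n + 2 =>
        have := neg _ (down _ (ih n (by omega)))
        convert this using 6 <;> push_cast <;> ring
  obtain ⟨n, rfl | rfl⟩ := k.eq_nat_or_neg
  · exact key n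
  · exact neg _ (key n)

theorem exists_isReflection_alpha₁ (k : ℤ) : ∃ t, cs.IsReflection t ∧
    ∀ w, C.A (t * w) = C.B w - C.A w + 3 * k ∧ C.B (t * w) = C.B w := by
  obtain ⟨t, ht, h⟩ := C.exists_isReflection_rho k
  refine ⟨_, ht.conj (cs.simple 2), fun w => ?_⟩
  simp only [cs.inv_simple, mul_assoc, C.A_s2, C.B_s2, h]; omega

theorem exists_isReflection_alpha₂ (k : ℤ) : ∃ t, cs.IsReflection t ∧
    ∀ w, C.A (t * w) = C.A w ∧ C.B (t * w) = C.A w - C.B w + 3 * k := by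
  obtain ⟨t, ht, h⟩ := C.exists_isReflection_rho k
  refine ⟨_, ht.conj (cs.simple 1), fun w => ?_⟩
  simp only [cs.inv_simple, mul_assoc, C.A_s1, C.B_s1, h]; omega

variable {C} in
theorem Position.lineCount_le_length {w : W} {i j e : ℤ} (h : C.Position w i j e) :
    lineCount i j e ≤ cs.length w := by
  induction hn : cs.length w generalizing w i j e with
  | zero =>
    rw [cs.length_eq_zero_iff] at hn
    subst hn
    rw [h.lineCount_eq C.position_one]
    simp [lineCount]
  | succ n ih =>
    have hw : w ≠ 1 := by rintro rfl; simp at hn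
    obtain ⟨m, hm⟩ := cs.exists_leftDescent_of_ne_one hw
    rw [cs.isLeftDescent_iff] at hm
    have he := h.1
    fin_cases m
    · have h' := ih h.s0 (by simpa [hn] using hm)
      simp only [lineCount] at h' ⊢; omega
    · have h' := ih h.s1 (by simpa [hn] using hm)
      simp only [lineCount] at h' ⊢; omega
    · have h' := ih h.s2 (by simpa [hn] using hm)
      simp only [lineCount] at h' ⊢; omega

variable {C} in
theorem Position.length_le_lineCount {w : W} {i j e : ℤ} (h : C.Position w i j e) :
    cs.length w ≤ lineCount i j e := by
  induction hn : lineCount i j e using Nat.strong_induction_on generalizing w i j e with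
  | _ n ih =>
    subst hn
    obtain ⟨he, ha, hb⟩ := id h
    have descend : ∀ m i' j' e', C.Position (cs.simple m * w) i' j' e' →
        lineCount i' j' e' < lineCount i j e → cs.length w ≤ lineCount i j e := by
      intro m i' j' e' h' hlt
      have := ih _ hlt h' rfl
      rcases cs.length_simple_mul w m with h'' | h'' <;> omega
    by_cases hi : 0 ≤ i
    · exact descend _ _ _ _ h.s1 (by simp only [lineCount]; omega)
    by_cases hj : 0 ≤ j
    · exact descend _ _ _ _ h.s2 (by simp only [lineCount]; omega)
    by_cases hr : i + j + e < 0
    · exact descend _ _ _ _ h.s0 (by simp only [lineCount]; omega)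
    have h₁ : w = 1 := C.ext _ _ (by rw [C.A_one]; omega) (by rw [C.B_one]; omega)
    simp [h₁]

variable {C} in
theorem Position.length_eq {w : W} {i j e : ℤ} (h : C.Position w i j e) :
    cs.length w = lineCount i j e :=
  le_antisymm h.length_le_lineCount h.lineCount_le_length

variable {C} in
theorem Position.bruhatStep {t w : W} {i j e i' j' e' : ℤ} (h : C.Position w i j e)
    (ht : cs.IsReflection t) (h' : C.Position (t * w) i' j' e')
    (hl : lineCount i j e < lineCount i' j' e') : BruhatStep cs w (t * w) :=
  ⟨⟨t, ht, rfl⟩, by rwa [h.length_eq, h'.length_eq]⟩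

variable {C} in
theorem Position.exists_step_alpha₁ {w : W} {i j e : ℤ} (h : C.Position w i j e) (k : ℤ)
    (hl : lineCount i j e < lineCount (2 * k - 1 - i) (i + j - k + e - 1) (3 - e)) :
    ∃ w', C.Position w' (2 * k - 1 - i) (i + j - k + e - 1) (3 - e) ∧ BruhatStep cs w w' := by
  obtain ⟨t, ht, htw⟩ := C.exists_isReflection_alpha₁ k
  have h' := h.alpha₁ k (htw w).1 (htw w).2
  exact ⟨_, h', h.bruhatStep ht h' hl⟩

variable {C} in
theorem Position.exists_step_alpha₂ {w : W} {i j e : ℤ} (h : C.Position w i j e) (k : ℤ)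
    (hl : lineCount i j e < lineCount (i + j - k + e - 1) (2 * k - 1 - j) (3 - e)) :
    ∃ w', C.Position w' (i + j - k + e - 1) (2 * k - 1 - j) (3 - e) ∧ BruhatStep cs w w' := by
  obtain ⟨t, ht, htw⟩ := C.exists_isReflection_alpha₂ k
  have h' := h.alpha₂ k (htw w).1 (htw w).2
  exact ⟨_, h', h.bruhatStep ht h' hl⟩

variable {C} in
theorem Position.exists_step_rho {w : W} {i j e : ℤ} (h : C.Position w i j e) (k : ℤ)
    (hl : lineCount i j e < lineCount (k - 1 - j) (k - 1 - i) (3 - e)) :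
    ∃ w', C.Position w' (k - 1 - j) (k - 1 - i) (3 - e) ∧ BruhatStep cs w w' := by
  obtain ⟨t, ht, htw⟩ := C.exists_isReflection_rho k
  have h' := h.rho k (htw w).1 (htw w).2
  exact ⟨_, h', h.bruhatStep ht h' hl⟩

/-- The alcove of `w` lies in the dominant chamber. -/
def Dominant (w : W) : Prop := 0 < 2 * C.A w - C.B w ∧ 0 < 2 * C.B w - C.A w

/-- The largest values of the two coordinates on the finite Weyl group orbit of the barycentre
increase along the Bruhat order. -/
theorem orbit_max_le_of_step {u v : W} (h : BruhatStep cs u v) :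
    max (C.A u) (max (C.B u - C.A u) (-C.B u)) ≤ max (C.A v) (max (C.B v - C.A v) (-C.B v)) ∧
    max (C.B u) (max (C.A u - C.B u) (-C.A u)) ≤
      max (C.B v) (max (C.A v - C.B v) (-C.A v)) := by
  obtain ⟨⟨t, ht, rfl⟩, hl⟩ := h
  obtain ⟨i, j, e, hu⟩ := C.exists_position u
  obtain ⟨he, ha, hb⟩ := id hu
  rw [hu.length_eq] at hl
  obtain ⟨k, h | h | h⟩ := C.actsAsReflection_of_isReflection ht <;> obtain ⟨ha', hb'⟩ := h u
  · rw [(hu.alpha₁ k ha' hb').length_eq] at hl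
    have hk : (i < k ∧ 0 ≤ k) ∨ (k ≤ i ∧ k < 0) := by
      simp only [lineCount] at hl; rcases he with rfl | rfl <;> omega
    rw [ha', hb']; clear h hl; rcases hk with hk | hk <;> constructor <;> omega
  · rw [(hu.alpha₂ k ha' hb').length_eq] at hl
    have hk : (j < k ∧ 0 ≤ k) ∨ (k ≤ j ∧ k < 0) := by
      simp only [lineCount] at hl; rcases he with rfl | rfl <;> omega
    rw [ha', hb']; clear h hl; rcases hk with hk | hk <;> constructor <;> omega
  · rw [(hu.rho k ha' hb').length_eq] at hl
    have hk : (i + j + e ≤ k ∧ 0 ≤ k) ∨ (k < i + j + e ∧ k < 0) := by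
      simp only [lineCount] at hl; rcases he with rfl | rfl <;> omega
    rw [ha', hb']
    have hr : (C.A u + C.B u < 3 * k ∧ 0 ≤ k) ∨ (3 * k < C.A u + C.B u ∧ k < 0) := by omega
    clear h hl hk hu ha hb ha' hb' he
    generalize C.A u = a at *
    generalize C.B u = b at *
    rcases hr with hr | hr <;> constructor <;> apply max_le _ (max_le _ _) <;> omega

theorem coords_le_of_bruhatLE {u v : W} (h : bruhatLE cs u v) (hv : C.Dominant v) :
    C.A u ≤ C.A v ∧ C.B u ≤ C.B v := by
  rcases h with rfl | h
  · exact ⟨le_rfl, le_rfl⟩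
  · have key : max (C.A u) (max (C.B u - C.A u) (-C.B u)) ≤
          max (C.A v) (max (C.B v - C.A v) (-C.B v)) ∧
        max (C.B u) (max (C.A u - C.B u) (-C.A u)) ≤
          max (C.B v) (max (C.A v - C.B v) (-C.A v)) := by
      clear hv
      induction h with
      | single h => exact C.orbit_max_le_of_step h
      | tail _ h ih => exact ⟨ih.1.trans (C.orbit_max_le_of_step h).1,
          ih.2.trans (C.orbit_max_le_of_step h).2⟩
    obtain ⟨h₁, h₂⟩ := hv
    omega

/-- On dominant elements, the dominance order on barycentres implies the Bruhat order. -/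
theorem bruhatLE_of_coords_le {x y : W} (hx : C.Dominant x) (hy : C.Dominant y)
    (ha : C.A x ≤ C.A y) (hb : C.B x ≤ C.B y) : bruhatLE cs x y := by
  induction hn : (C.A y - C.A x + (C.B y - C.B x)).toNat using Nat.strong_induction_on
    generalizing x with
  | _ n ih =>
    subst hn
    by_cases hxy : x = y
    · exact Or.inl hxy
    have hne : C.A x ≠ C.A y ∨ C.B x ≠ C.B y := by
      by_contra! h
      exact hxy (C.ext _ _ h.1 h.2)
    obtain ⟨i, j, e, hpx⟩ := C.exists_position x
    obtain ⟨i', j', e', he', hya, hyb⟩ := C.exists_position y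
    obtain ⟨he, hxa, hxb⟩ := id hpx
    obtain ⟨hp, hq⟩ := hx
    obtain ⟨hp', hq'⟩ := hy
    have next : ∀ w i₁ j₁ e₁, C.Position w i₁ j₁ e₁ ∧ BruhatStep cs x w → 0 ≤ i₁ → 0 ≤ j₁ →
        2 * i₁ + j₁ + e₁ ≤ C.A y → i₁ + 2 * j₁ + e₁ ≤ C.B y →
        i + j < i₁ + j₁ ∨ i + j = i₁ + j₁ ∧ e < e₁ → bruhatLE cs x y := by
      rintro w i₁ j₁ e₁ ⟨⟨he₁, hwa, hwb⟩, hw⟩ h₁ h₂ h₃ h₄ h₅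
      exact hw.le.trans (ih _ (by omega) ⟨by omega, by omega⟩ (by omega) (by omega) rfl)
    by_cases hα₁ : C.A x < C.A y ∧ (e = 2 ∨ C.B x = C.B y)
    · obtain ⟨w, hw⟩ := hpx.exists_step_alpha₁ (i + 1) (by simp only [lineCount]; omega)
      exact next _ _ _ _ hw (by omega) (by omega) (by omega) (by omega) (by omega)
    by_cases hα₂ : C.B x < C.B y ∧ (e = 2 ∨ C.A x = C.A y)
    · obtain ⟨w, hw⟩ := hpx.exists_step_alpha₂ (j + 1) (by simp only [lineCount]; omega)
      exact next _ _ _ _ hw (by omega) (by omega) (by omega) (by omega) (by omega)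
    obtain ⟨w, hw⟩ := hpx.exists_step_rho (i + j + e) (by simp only [lineCount]; omega)
    exact next _ _ _ _ hw (by omega) (by omega) (by omega) (by omega) (by omega)

/-- Far enough from the walls, every Bruhat cover of `x` is below `y`. -/
theorem cover_bruhatLE {x y w : W} (hp : 3 ≤ 2 * C.A x - C.B x) (hq : 3 ≤ 2 * C.B x - C.A x)
    (hy : C.Dominant y) (ha : C.A x + 3 ≤ C.A y) (hb : C.B x + 3 ≤ C.B y)
    (hw : BruhatStep cs x w) (hl : cs.length w = cs.length x + 1) : bruhatLE cs w y := by
  obtain ⟨⟨t, ht, rfl⟩, -⟩ := hw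
  obtain ⟨i, j, e, hx'⟩ := C.exists_position x
  obtain ⟨he, hxa, hxb⟩ := id hx'
  rw [hx'.length_eq] at hl
  obtain ⟨k, h | h | h⟩ := C.actsAsReflection_of_isReflection ht <;> obtain ⟨ha', hb'⟩ := h x
  · have hw := hx'.alpha₁ k ha' hb'
    rw [hw.length_eq] at hl
    have hk : k = i + 1 ∨ k = -1 := by
      simp only [lineCount] at hl; rcases he with rfl | rfl <;> omega
    rcases hk with rfl | rfl
    · exact C.bruhatLE_of_coords_le ⟨by omega, by omega⟩ hy (by omega) (by omega)
    · obtain ⟨v, hv, hs⟩ := hw.exists_step_alpha₁ 0 (by simp only [lineCount]; omega)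
      obtain ⟨-, hva, hvb⟩ := hv
      exact hs.le.trans
        (C.bruhatLE_of_coords_le ⟨by omega, by omega⟩ hy (by omega) (by omega))
  · have hw := hx'.alpha₂ k ha' hb'
    rw [hw.length_eq] at hl
    have hk : k = j + 1 ∨ k = -1 := by
      simp only [lineCount] at hl; rcases he with rfl | rfl <;> omega
    rcases hk with rfl | rfl
    · exact C.bruhatLE_of_coords_le ⟨by omega, by omega⟩ hy (by omega) (by omega)
    · obtain ⟨v, hv, hs⟩ := hw.exists_step_alpha₂ 0 (by simp only [lineCount]; omega)
      obtain ⟨-, hva, hvb⟩ := hv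
      exact hs.le.trans
        (C.bruhatLE_of_coords_le ⟨by omega, by omega⟩ hy (by omega) (by omega))
  · have hw := hx'.rho k ha' hb'
    rw [hw.length_eq] at hl
    have hk : k = i + j + e ∨ k = -1 := by
      simp only [lineCount] at hl; rcases he with rfl | rfl <;> omega
    rcases hk with rfl | rfl
    · exact C.bruhatLE_of_coords_le ⟨by omega, by omega⟩ hy (by omega) (by omega)
    · obtain ⟨v, hv, hs⟩ := hw.exists_step_rho 0 (by simp only [lineCount]; omega)
      obtain ⟨-, hva, hvb⟩ := hv
      exact hs.le.trans
        (C.bruhatLE_of_coords_le ⟨by omega, by omega⟩ hy (by omega) (by omega))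

/-- Far enough from the walls, every Bruhat cocover of `y` is above `x`. -/
theorem bruhatLE_cocover {x y w : W} (hx : C.Dominant x) (hp : 6 ≤ 2 * C.A y - C.B y)
    (hq : 6 ≤ 2 * C.B y - C.A y) (ha : C.A x + 3 ≤ C.A y) (hb : C.B x + 3 ≤ C.B y)
    (hw : BruhatStep cs w y) (hl : cs.length y = cs.length w + 1) : bruhatLE cs x w := by
  obtain ⟨⟨t, ht, hty⟩, -⟩ := hw
  obtain rfl : t * y = w := by rw [hty, ← mul_assoc, ht.mul_self, one_mul]
  clear hty
  obtain ⟨i, j, e, hy'⟩ := C.exists_position y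
  obtain ⟨he, hya, hyb⟩ := id hy'
  rw [hy'.length_eq] at hl
  obtain ⟨k, h | h | h⟩ := C.actsAsReflection_of_isReflection ht <;> obtain ⟨ha', hb'⟩ := h y
  · have hw := hy'.alpha₁ k ha' hb'
    rw [hw.length_eq] at hl
    have hk : k = i ∨ k = 0 := by
      simp only [lineCount] at hl; rcases he with rfl | rfl <;> omega
    rcases hk with rfl | rfl
    · exact C.bruhatLE_of_coords_le hx ⟨by omega, by omega⟩ (by omega) (by omega)
    · obtain ⟨r, hr, hrw⟩ := C.exists_isReflection_alpha₁ (-1)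
      have hv := hw.alpha₁ (-1) (hrw _).1 (hrw _).2
      have hs : BruhatStep cs (r * (t * y)) (t * y) := by
        refine ⟨⟨r, hr, by rw [← mul_assoc, hr.mul_self, one_mul]⟩, ?_⟩
        rw [hv.length_eq, hw.length_eq]; simp only [lineCount]; omega
      obtain ⟨-, hva, hvb⟩ := hv
      exact (C.bruhatLE_of_coords_le hx ⟨by omega, by omega⟩ (by omega) (by omega)).trans hs.le
  · have hw := hy'.alpha₂ k ha' hb'
    rw [hw.length_eq] at hl
    have hk : k = j ∨ k = 0 := by
      simp only [lineCount] at hl; rcases he with rfl | rfl <;> omega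
    rcases hk with rfl | rfl
    · exact C.bruhatLE_of_coords_le hx ⟨by omega, by omega⟩ (by omega) (by omega)
    · obtain ⟨r, hr, hrw⟩ := C.exists_isReflection_alpha₂ (-1)
      have hv := hw.alpha₂ (-1) (hrw _).1 (hrw _).2
      have hs : BruhatStep cs (r * (t * y)) (t * y) := by
        refine ⟨⟨r, hr, by rw [← mul_assoc, hr.mul_self, one_mul]⟩, ?_⟩
        rw [hv.length_eq, hw.length_eq]; simp only [lineCount]; omega
      obtain ⟨-, hva, hvb⟩ := hv
      exact (C.bruhatLE_of_coords_le hx ⟨by omega, by omega⟩ (by omega) (by omega)).trans hs.le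
  · have hw := hy'.rho k ha' hb'
    rw [hw.length_eq] at hl
    have hk : k = i + j + e - 1 ∨ k = 0 := by
      simp only [lineCount] at hl; rcases he with rfl | rfl <;> omega
    rcases hk with rfl | rfl
    · exact C.bruhatLE_of_coords_le hx ⟨by omega, by omega⟩ (by omega) (by omega)
    · obtain ⟨r, hr, hrw⟩ := C.exists_isReflection_rho (-1)
      have hv := hw.rho (-1) (hrw _).1 (hrw _).2
      have hs : BruhatStep cs (r * (t * y)) (t * y) := by
        refine ⟨⟨r, hr, by rw [← mul_assoc, hr.mul_self, one_mul]⟩, ?_⟩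
        rw [hv.length_eq, hw.length_eq]; simp only [lineCount]; omega
      obtain ⟨-, hva, hvb⟩ := hv
      exact (C.bruhatLE_of_coords_le hx ⟨by omega, by omega⟩ (by omega) (by omega)).trans hs.le

/-- The alcove coordinates coming from an action of `W` on the plane. -/
theorem exists_of_action {act : W →* Equiv.Perm E2}
    (h0 : ∀ v, act (cs.simple 0) v = reflE rho2 (-1) v)
    (h1 : ∀ v, act (cs.simple 1) v = reflE a1 0 v)
    (h2 : ∀ v, act (cs.simple 2) v = reflE a2 0 v)
    (hcen : Function.Injective (cen act)) :
    ∃ C : AlcoveCoords cs, ∀ w, cen act w = ((C.A w : ℝ) / 3, (C.B w : ℝ) / 3) := by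
  have hone : cen act 1 = (((-1 : ℤ) : ℝ) / 3, ((-1 : ℤ) : ℝ) / 3) := by
    simp [cen, rho2]; norm_num
  have hmul : ∀ i w, cen act (cs.simple i * w) = act (cs.simple i) (cen act w) := by
    simp [cen]
  have hs0 : ∀ w (a b : ℤ), cen act w = ((a : ℝ) / 3, (b : ℝ) / 3) →
      cen act (cs.simple 0 * w) = (((-b - 3 : ℤ) : ℝ) / 3, ((-a - 3 : ℤ) : ℝ) / 3) := by
    intro w a b h
    rw [hmul, h, h0]
    ext <;> simp [reflE, B2, rho2] <;> ring
  have hs1 : ∀ w (a b : ℤ), cen act w = ((a : ℝ) / 3, (b : ℝ) / 3) →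
      cen act (cs.simple 1 * w) = (((b - a : ℤ) : ℝ) / 3, ((b : ℤ) : ℝ) / 3) := by
    intro w a b h
    rw [hmul, h, h1]
    ext <;> simp [reflE, B2, a1]; ring
  have hs2 : ∀ w (a b : ℤ), cen act w = ((a : ℝ) / 3, (b : ℝ) / 3) →
      cen act (cs.simple 2 * w) = (((a : ℤ) : ℝ) / 3, ((a - b : ℤ) : ℝ) / 3) := by
    intro w a b h
    rw [hmul, h, h2]
    ext <;> simp [reflE, B2, a2]; ring
  have hex : ∀ w, ∃ a b : ℤ, cen act w = ((a : ℝ) / 3, (b : ℝ) / 3) := by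
    intro w
    induction w using cs.simple_induction_left with
    | one => exact ⟨_, _, hone⟩
    | mul_simple_left w i ih =>
      obtain ⟨a, b, h⟩ := ih
      fin_cases i
      · exact ⟨_, _, hs0 w a b h⟩
      · exact ⟨_, _, hs1 w a b h⟩
      · exact ⟨_, _, hs2 w a b h⟩
  choose A B hAB using hex
  have huniq : ∀ w (a b : ℤ), cen act w = ((a : ℝ) / 3, (b : ℝ) / 3) → A w = a ∧ B w = b := by
    intro w a b h
    rw [hAB, Prod.mk.injEq, div_left_inj' three_ne_zero, div_left_inj' three_ne_zero] at h
    exact_mod_cast h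
  exact ⟨{  A := A
            B := B
            ext := fun u v ha hb => hcen (by rw [hAB, hAB, ha, hb])
            A_one := (huniq _ _ _ hone).1
            B_one := (huniq _ _ _ hone).2
            A_s0 := fun w => (huniq _ _ _ (hs0 w _ _ (hAB w))).1
            B_s0 := fun w => (huniq _ _ _ (hs0 w _ _ (hAB w))).2
            A_s1 := fun w => (huniq _ _ _ (hs1 w _ _ (hAB w))).1
            B_s1 := fun w => (huniq _ _ _ (hs1 w _ _ (hAB w))).2
            A_s2 := fun w => (huniq _ _ _ (hs2 w _ _ (hAB w))).1
            B_s2 := fun w => (huniq _ _ _ (hs2 w _ _ (hAB w))).2 }, hAB⟩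

end AlcoveCoords

/-- a thick interval has endpoints of the form `x₀ + ρ`, `y₀ + ρ` with
`x₀, y₀` dominant, contains `x + ρ` and `y - ρ`, and is full. -/
theorem statement11
    {W : Type*} [Group W] {M : CoxeterMatrix (Fin 3)} (cs : CoxeterSystem M W)
    (hM : ∀ i j : Fin 3, M i j = if i = j then 1 else 3)
    (act : W →* Equiv.Perm E2)
    (h0 : ∀ v, act (cs.simple 0) v = reflE rho2 (-1) v)
    (h1 : ∀ v, act (cs.simple 1) v = reflE a1 0 v)
    (h2 : ∀ v, act (cs.simple 2) v = reflE a2 0 v)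
    (hcen : Function.Injective (cen act))
    (th ths : ℕ → ℕ → W)
    (hth : ∀ m n : ℕ, cen act (th m n) =
      cen act (cs.simple 1 * cs.simple 2 * cs.simple 1) + (m : ℝ) • fw1 + (n : ℝ) • fw2)
    (hths : ∀ m n : ℕ, cen act (ths m n) =
      cen act 1 + ((m : ℝ) + 1) • fw1 + ((n : ℝ) + 1) • fw2)
    (Wadd : W → E2 → W)
    (hWadd : ∀ (z : W), ∀ v ∈ wLat, cen act (Wadd z v) = cen act z + v)
    (x y : W) (hx : x ∈ Dset th ths) (hy : y ∈ Dset th ths) (hxy : bruhatLE cs x y)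
    (hthick : Thick cs act Wadd x y) :
    ((∃ x0 ∈ Dset th ths, x = Wadd x0 rho2) ∧ (∃ y0 ∈ Dset th ths, y = Wadd y0 rho2) ∧
      Wadd x rho2 ∈ Iset cs x y ∧ Wadd y (-rho2) ∈ Iset cs x y) ∧
    FullInt cs x y := by
  obtain ⟨C, hC⟩ := AlcoveCoords.exists_of_action h0 h1 h2 hcen
  have coords : ∀ w (a b : ℤ), cen act w = ((a : ℝ) / 3, (b : ℝ) / 3) →
      C.A w = a ∧ C.B w = b := by
    intro w a b h
    rw [hC, Prod.mk.injEq, div_left_inj' three_ne_zero, div_left_inj' three_ne_zero] at h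
    exact_mod_cast h
  have hadd : ∀ z (m n : ℤ) (v : E2), v = (m : ℝ) • fw1 + (n : ℝ) • fw2 →
      C.A (Wadd z v) = C.A z + 2 * m + n ∧ C.B (Wadd z v) = C.B z + m + 2 * n := by
    intro z m n v hv
    apply coords
    rw [hWadd z v ⟨m, n, hv⟩, hC, hv]
    ext <;> simp [fw1, fw2] <;> ring
  have hFid : ∀ w, cen act w ∈ Fid → -3 ≤ 2 * C.A w - C.B w ∧ -3 ≤ 2 * C.B w - C.A w := by
    intro w h
    rw [hC] at h
    obtain ⟨ha, hb, -⟩ := h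
    simp only [B2, a1, a2] at ha hb
    constructor
    · have : (-3 : ℝ) ≤ 2 * C.A w - C.B w := by linarith
      exact_mod_cast this
    · have : (-3 : ℝ) ≤ 2 * C.B w - C.A w := by linarith
      exact_mod_cast this
  have hthC : ∀ m n : ℕ, C.A (th m n) = 1 + 2 * m + n ∧ C.B (th m n) = 1 + m + 2 * n := by
    intro m n
    apply coords
    rw [hth, hC]
    simp only [mul_assoc, C.A_s1, C.B_s1, C.A_s2, C.B_s2]
    rw [← mul_one (cs.simple 1)]
    simp only [C.A_s1, C.B_s1, C.A_one, C.B_one]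
    ext <;> simp [fw1, fw2] <;> ring
  have hthsC : ∀ m n : ℕ, C.A (ths m n) = 2 + 2 * m + n ∧ C.B (ths m n) = 2 + m + 2 * n := by
    intro m n
    apply coords
    rw [hths, hC, C.A_one, C.B_one]
    ext <;> simp [fw1, fw2] <;> ring
  have hrho : rho2 = ((1 : ℤ) : ℝ) • fw1 + ((1 : ℤ) : ℝ) • fw2 := by
    ext <;> simp [rho2, fw1, fw2] <;> norm_num
  have hrho' : -rho2 = ((-1 : ℤ) : ℝ) • fw1 + ((-1 : ℤ) : ℝ) • fw2 := by
    ext <;> simp [rho2, fw1, fw2] <;> norm_num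
  have ha₁ : (2 : ℝ) • a1 = ((4 : ℤ) : ℝ) • fw1 + ((-2 : ℤ) : ℝ) • fw2 := by
    ext <;> simp [a1, fw1, fw2] <;> norm_num
  have ha₂ : (2 : ℝ) • a2 = ((-2 : ℤ) : ℝ) • fw1 + ((4 : ℤ) : ℝ) • fw2 := by
    ext <;> simp [a2, fw1, fw2] <;> norm_num
  have ha₁' : -((2 : ℝ) • a1) = ((-4 : ℤ) : ℝ) • fw1 + ((2 : ℤ) : ℝ) • fw2 := by
    ext <;> simp [a1, fw1, fw2] <;> norm_num
  have ha₂' : -((2 : ℝ) • a2) = ((2 : ℤ) : ℝ) • fw1 + ((-4 : ℤ) : ℝ) • fw2 := by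
    ext <;> simp [a2, fw1, fw2] <;> norm_num
  have hdom : ∀ w ∈ Dset th ths, C.Dominant w := by
    rintro w (⟨m, n, rfl⟩ | ⟨m, n, rfl⟩)
    · have := hthC m n; exact ⟨by omega, by omega⟩
    · have := hthsC m n; exact ⟨by omega, by omega⟩
  have hsub : ∀ w ∈ Dset th ths, 3 ≤ 2 * C.A w - C.B w → 3 ≤ 2 * C.B w - C.A w →
      ∃ w₀ ∈ Dset th ths, w = Wadd w₀ rho2 := by
    rintro w (⟨m, n, rfl⟩ | ⟨m, n, rfl⟩) hp hq
    · have hmn := hthC m n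
      have hmn' := hthC (m - 1) (n - 1)
      have := hadd (th (m - 1) (n - 1)) 1 1 rho2 hrho
      exact ⟨_, Or.inl ⟨m - 1, n - 1, rfl⟩, C.ext _ _ (by omega) (by omega)⟩
    · have hmn := hthsC m n
      have hmn' := hthsC (m - 1) (n - 1)
      have := hadd (ths (m - 1) (n - 1)) 1 1 rho2 hrho
      exact ⟨_, Or.inr ⟨m - 1, n - 1, rfl⟩, C.ext _ _ (by omega) (by omega)⟩
  obtain ⟨⟨-, hx₁⟩, ⟨-, hx₂⟩, -, -, hf₁, hf₂, hf₃, hf₄⟩ := hthick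
  replace hx₁ := C.coords_le_of_bruhatLE hx₁ (hdom y hy)
  replace hx₂ := C.coords_le_of_bruhatLE hx₂ (hdom y hy)
  replace hf₁ := hFid _ hf₁
  replace hf₂ := hFid _ hf₂
  replace hf₃ := hFid _ hf₃
  replace hf₄ := hFid _ hf₄
  have hxa₁ := hadd x _ _ _ ha₁
  have hxa₂ := hadd x _ _ _ ha₂
  have hya₁ := hadd y _ _ _ ha₁'
  have hya₂ := hadd y _ _ _ ha₂'
  have hxρ := hadd x _ _ _ hrho
  have hyρ := hadd y _ _ _ hrho'
  have hxp : 3 ≤ 2 * C.A x - C.B x := by omega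
  have hxq : 3 ≤ 2 * C.B x - C.A x := by omega
  have hyp : 9 ≤ 2 * C.A y - C.B y := by omega
  have hyq : 9 ≤ 2 * C.B y - C.A y := by omega
  have hA : C.A x + 6 ≤ C.A y := by omega
  have hB : C.B x + 6 ≤ C.B y := by omega
  have hdx := hdom x hx
  have hdy := hdom y hy
  have hdxρ : C.Dominant (Wadd x rho2) := ⟨by omega, by omega⟩
  have hdyρ : C.Dominant (Wadd y (-rho2)) := ⟨by omega, by omega⟩
  refine ⟨⟨hsub x hx hxp hxq, hsub y hy (by omega) (by omega), ⟨?_, ?_⟩, ⟨?_, ?_⟩⟩, ?_, ?_⟩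
  · exact C.bruhatLE_of_coords_le hdx hdxρ (by omega) (by omega)
  · exact C.bruhatLE_of_coords_le hdxρ hdy (by omega) (by omega)
  · exact C.bruhatLE_of_coords_le hdx hdyρ (by omega) (by omega)
  · exact C.bruhatLE_of_coords_le hdyρ hdy (by omega) (by omega)
  · rintro w ⟨hw, hl⟩
    exact ⟨Or.inr hw, C.cover_bruhatLE hxp hxq hdy (by omega) (by omega)
      (bruhatStep_of_bruhatLT hw hl) hl⟩
  · rintro w ⟨hw, hl⟩
    exact ⟨C.bruhatLE_cocover hdx (by omega) (by omega) (by omega) (by omega)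
      (bruhatStep_of_bruhatLT hw hl) hl, Or.inr hw⟩
end
end

section
/- Let x, x', y, y' be dominant elements of W such that the intervals [x,y] and [x',y'] are thick, and let φ : [x,y] → [x',y'] be an isomorphism of posets. Then φ(x + ρ) = x' + ρ. -/
noncomputable section

open scoped RealInnerProductSpace

/-- Triples of integers, recording the position of an alcove of type affine `A₂` with respect to
the mirrors of the three directions. -/
abbrev Tri : Type := ℤ × ℤ × ℤ

/-- The action of the reflection in the `k`-th mirror of a given direction. -/
def Tri.reflect : Fin 3 → ℤ → Tri → Tri
  | 1, k, (p, q, r) => (2 * k + 1 - p, -k - r, -k - q)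
  | 2, k, (p, q, r) => (-k - r, 2 * k + 1 - q, -k - p)
  | 0, k, (p, q, r) => (-k - q, -k - p, 2 * k + 1 - r)

/-- The number of mirrors separating an alcove from the fundamental one. -/
def Tri.size (z : Tri) : ℕ := z.1.natAbs + z.2.1.natAbs + z.2.2.natAbs

/-- The triples that are coordinates of an alcove. -/
def Tri.Valid (z : Tri) : Prop := z.1 + z.2.1 + z.2.2 = 0 ∨ z.1 + z.2.1 + z.2.2 = 1

/-- The coordinate of an alcove in a given direction. -/
def Tri.coord : Fin 3 → Tri → ℤ
  | 1, z => z.1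
  | 2, z => z.2.1
  | 0, z => z.2.2

/-- The alcove `w` is a reflection of `z` of greater size. -/
def Tri.Step (z w : Tri) : Prop := ∃ i k, w = Tri.reflect i k z ∧ z.size < w.size

/-- The alcove `w` is a reflection of `z` whose size is greater by one. -/
def Tri.Cover (z w : Tri) : Prop := ∃ i k, w = Tri.reflect i k z ∧ w.size = z.size + 1

/-- Rotation around the barycenter of the fundamental alcove. -/
def Tri.rot (z : Tri) : Tri := (z.2.1, z.2.2, z.1)

namespace Tri

theorem Valid.reflect {z : Tri} (h : z.Valid) (i : Fin 3) (k : ℤ) : (Tri.reflect i k z).Valid := by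
  obtain ⟨p, q, r⟩ := z
  fin_cases i <;> simp only [Valid, Tri.reflect] at * <;> omega

theorem cover_index {z : Tri} (h : z.Valid) {i : Fin 3} {k : ℤ}
    (hk : (Tri.reflect i k z).size = z.size + 1) :
    (0 ≤ coord i z ∧ (k = coord i z ∨ k = -1)) ∨
      (coord i z < 0 ∧ (k = 0 ∨ k = coord i z - 1)) := by
  obtain ⟨p, q, r⟩ := z
  fin_cases i <;> simp only [Valid, Tri.reflect, size, coord] at * <;> omega

theorem size_simple (i : Fin 3) {z : Tri} (h : z.Valid) :
    (Tri.reflect i 0 z).size = z.size + 1 ∨ (Tri.reflect i 0 z).size + 1 = z.size := by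
  obtain ⟨p, q, r⟩ := z
  fin_cases i <;> simp only [Valid, Tri.reflect, size] at * <;> omega

theorem exists_descent {z : Tri} (h : z.Valid) (hz : z ≠ (0, 0, 0)) :
    ∃ i, (Tri.reflect i 0 z).size + 1 = z.size := by
  obtain ⟨p, q, r⟩ := z
  simp only [Valid, ne_eq, Prod.mk.injEq] at *
  have : 0 < p ∨ 0 < q ∨ 0 < r := by omega
  rcases this with h | h | h
  · exact ⟨1, by simp only [Tri.reflect, size]; omega⟩
  · exact ⟨2, by simp only [Tri.reflect, size]; omega⟩
  · exact ⟨0, by simp only [Tri.reflect, size]; omega⟩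

theorem size_rot (z : Tri) : (rot z).size = z.size := by
  simp only [rot, size]; omega

theorem Valid.rot {z : Tri} (h : z.Valid) : (rot z).Valid := by
  simp only [Tri.rot, Valid] at *; omega

theorem rot_reflect (i : Fin 3) (k : ℤ) (z : Tri) :
    rot (Tri.reflect i k z) = Tri.reflect (i - 1) k (rot z) := by
  obtain ⟨p, q, r⟩ := z
  fin_cases i <;> rfl

theorem Step.rot {z w : Tri} (h : Step z w) : Step (rot z) (rot w) := by
  obtain ⟨i, k, rfl, hs⟩ := h
  exact ⟨i - 1, k, rot_reflect i k z, by simpa only [size_rot] using hs⟩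

/-- One can go from `z` to `w` in three steps. -/
def Refines (z w : Tri) : Prop :=
  ∃ u v, Step z u ∧ Step u v ∧ Step v w

theorem Refines.rot {z w : Tri} (h : Refines z w) : Refines (rot z) (rot w) := by
  obtain ⟨u, v, h₁, h₂, h₃⟩ := h
  exact ⟨_, _, h₁.rot, h₂.rot, h₃.rot⟩

theorem step_of_natAbs_lt {z : Tri} (hz : z.Valid) (k : ℤ)
    (h : z.1.natAbs < (2 * k + 1 - z.1).natAbs) : Step z (Tri.reflect 1 k z) := by
  obtain ⟨p, q, r⟩ := z
  refine ⟨1, k, rfl, ?_⟩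
  simp only [Valid, Tri.reflect, size] at *
  omega

theorem refines_of_natAbs_lt {z : Tri} (hz : z.Valid) {k : ℤ}
    (h : z.1.natAbs + 1 < (2 * k + 1 - z.1).natAbs) : Refines z (Tri.reflect 1 k z) := by
  have lift : ∀ a b c : ℤ, a - b + c = k → z.1.natAbs < (2 * a + 1 - z.1).natAbs →
      (2 * a + 1 - z.1).natAbs < (2 * b - 2 * a + z.1).natAbs →
      (2 * b - 2 * a + z.1).natAbs < (2 * k + 1 - z.1).natAbs →
      Refines z (Tri.reflect 1 k z) := by
    intro a b c habc h₁ h₂ h₃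
    have e : Tri.reflect 1 k z = Tri.reflect 1 c (Tri.reflect 1 b (Tri.reflect 1 a z)) := by
      simp only [Tri.reflect, Prod.mk.injEq]
      omega
    refine ⟨Tri.reflect 1 a z, Tri.reflect 1 b (Tri.reflect 1 a z), ?_, ?_, ?_⟩
    · exact step_of_natAbs_lt hz a h₁
    · refine step_of_natAbs_lt (hz.reflect _ _) b ?_
      simp only [Tri.reflect]
      omega
    · rw [e]
      refine step_of_natAbs_lt ((hz.reflect _ _).reflect _ _) c ?_
      simp only [Tri.reflect]
      omega
  rcases le_or_gt 0 z.1 with h0 | h0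
  · exact lift z.1 (-1) (k - z.1 - 1) (by omega) (by omega) (by omega) (by omega)
  · exact lift 0 (-1) (k - 1) (by omega) (by omega) (by omega) (by omega)

theorem refines_reflect_one {z : Tri} (hz : z.Valid) {k : ℤ}
    (h : z.size + 1 < (Tri.reflect 1 k z).size) : Refines z (Tri.reflect 1 k z) := by
  by_cases hp : z.1.natAbs + 1 < (2 * k + 1 - z.1).natAbs
  · exact refines_of_natAbs_lt hz hp
  obtain ⟨p, q, r⟩ := z
  have hlt : p.natAbs < (2 * k + 1 - p).natAbs := by
    simp only [Tri.reflect, size, Valid] at *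
    omega
  have hk : (0 ≤ p ∧ (k = -1 ∨ k = p)) ∨ (p < 0 ∧ (k = 0 ∨ k = p - 1)) := by
    simp only at *
    omega
  clear hp hlt
  rcases hk with ⟨h0, rfl | rfl⟩ | ⟨h0, rfl | rfl⟩
  · have : q ≤ 0 ∧ r ≤ 0 := by
      simp only [Tri.reflect, size, Valid] at *
      omega
    refine ⟨(-r, 1 - q, -p), (q - 1, r, p + 1), ⟨2, 0, ?_⟩, ⟨0, 0, ?_⟩, ⟨2, 0, ?_⟩⟩ <;>
    simp only [Tri.reflect, Prod.mk.injEq, size] <;> omega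
  · have : q ≤ 0 ∧ r ≤ 0 ∧ k + q + r = 1 := by
      simp only [Tri.reflect, size, Valid] at *
      omega
    refine ⟨(k, q - 1, r), (k + 1, q, r - 1), ⟨2, q - 1, ?_⟩, ⟨0, r - 1, ?_⟩, ⟨2, q - 1, ?_⟩⟩ <;>
    simp only [Tri.reflect, Prod.mk.injEq, size] <;> omega
  · simp only [Tri.reflect, size, Valid] at *
    omega
  · have : 0 ≤ q ∧ 0 ≤ r ∧ p + q + r = 0 := by
      simp only [Tri.reflect, size, Valid] at *
      omega
    refine ⟨(p, q + 1, r), (p - 1, q, r + 1), ⟨2, q, ?_⟩, ⟨0, r, ?_⟩, ⟨2, q, ?_⟩⟩ <;>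
    simp only [Tri.reflect, Prod.mk.injEq, size] <;> omega

theorem refines {z w : Tri} (hz : z.Valid) {i : Fin 3} {k : ℤ} (hw : w = Tri.reflect i k z)
    (h : z.size + 1 < w.size) : Refines z w := by
  subst hw
  match i with
  | 1 => exact refines_reflect_one hz h
  | 2 =>
    have := refines_reflect_one hz.rot (k := k) (by
      rw [show (1 : Fin 3) = 2 - 1 from rfl, ← rot_reflect, size_rot, size_rot]; exact h)
    rw [show (1 : Fin 3) = 2 - 1 from rfl, ← rot_reflect] at this
    exact this.rot.rot
  | 0 =>
    have := refines_reflect_one hz.rot.rot (k := k) (by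
      rw [show (1 : Fin 3) = 0 - 1 - 1 from rfl, ← rot_reflect, ← rot_reflect]
      simpa only [size_rot] using h)
    rw [show (1 : Fin 3) = 0 - 1 - 1 from rfl, ← rot_reflect, ← rot_reflect] at this
    exact this.rot

theorem Step.size_lt {z w : Tri} (h : Step z w) : z.size < w.size := h.choose_spec.choose_spec.2

theorem Step.valid {z w : Tri} (h : Step z w) (hz : z.Valid) : w.Valid := by
  obtain ⟨i, k, rfl, -⟩ := h
  exact hz.reflect i k

theorem Step.exists_cover {z w : Tri} (hz : z.Valid) (h : Step z w) :
    ∃ c, Cover z c ∧ Relation.ReflTransGen Step c w := by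
  induction hn : w.size using Nat.strong_induction_on generalizing w with
  | _ n ih =>
    subst hn
    obtain ⟨i, k, hw, hs⟩ := h
    by_cases h1 : w.size = z.size + 1
    · exact ⟨w, ⟨i, k, hw, h1⟩, .refl⟩
    · obtain ⟨u, v, h₁, h₂, h₃⟩ := refines hz hw (by omega)
      obtain ⟨c, hc, hcu⟩ := ih _ (h₂.size_lt.trans h₃.size_lt) h₁ rfl
      exact ⟨c, hc, (hcu.tail h₂).tail h₃⟩

/-- The extent of the hexagon spanned by the orbit of an alcove in the direction of `ϖ₁`. -/
def width₁ (z : Tri) : ℤ := max (z.1 - z.2.2) (max (z.2.1 - z.1) (z.2.2 - z.2.1))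

/-- The extent of the hexagon spanned by the orbit of an alcove in the direction of `ϖ₂`. -/
def width₂ (z : Tri) : ℤ := max (z.2.1 - z.2.2) (max (z.1 - z.2.1) (z.2.2 - z.1))

theorem Step.width_le {z w : Tri} (hz : z.Valid) (h : Step z w) :
    width₁ z ≤ width₁ w ∧ width₂ z ≤ width₂ w := by
  obtain ⟨i, k, rfl, hs⟩ := h
  obtain ⟨p, q, r⟩ := z
  match i with
  | 1 =>
    have : (0 ≤ k ∧ p ≤ k) ∨ (k < 0 ∧ k < p) := by
      simp only [Valid, Tri.reflect, size] at *; omega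
    simp only [Valid, Tri.reflect, width₁, width₂] at *; omega
  | 2 =>
    have : (0 ≤ k ∧ q ≤ k) ∨ (k < 0 ∧ k < q) := by
      simp only [Valid, Tri.reflect, size] at *; omega
    simp only [Valid, Tri.reflect, width₁, width₂] at *; omega
  | 0 =>
    have : (0 ≤ k ∧ r ≤ k) ∨ (k < 0 ∧ k < r) := by
      simp only [Valid, Tri.reflect, size] at *; omega
    simp only [Valid, Tri.reflect, width₁, width₂] at *; omega

end Tri

/-- The integral affine form `(i, j) ↦ a i + b j + c`, regarded as a function on `ℕ × ℕ`. -/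
abbrev Form : Type := ℤ × ℤ × ℤ

namespace Form

/-- The constant form. -/
def const (c : ℤ) : Form := (0, 0, c)

/-- The value of a form at `(i, j)`. -/
def eval (i j : ℕ) (f : Form) : ℤ := f.1 * i + f.2.1 * j + f.2.2

/-- A sufficient condition for `f` to take only nonnegative values. -/
def nonneg (f : Form) : Bool := decide (0 ≤ f.1) && decide (0 ≤ f.2.1) && decide (0 ≤ f.2.2)

/-- A sufficient condition for `f` to have no zero. -/
def nonzero (f : Form) : Bool := nonneg (f - Form.const 1) || nonneg (-f - Form.const 1)

/-- The absolute value of a form of constant sign. -/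
def abs (f : Form) : Form := if nonneg f then f else -f

/-- The sign of `f` is constant for evident reasons. -/
def signed (f : Form) : Bool := nonneg f || nonneg (-f)

theorem eval_add (i j : ℕ) (f g : Form) : eval i j (f + g) = eval i j f + eval i j g := by
  simp only [eval, Prod.fst_add, Prod.snd_add]; ring

theorem eval_neg (i j : ℕ) (f : Form) : eval i j (-f) = -eval i j f := by
  simp only [eval, Prod.fst_neg, Prod.snd_neg]; ring

theorem eval_sub (i j : ℕ) (f g : Form) : eval i j (f - g) = eval i j f - eval i j g := by
  simp only [eval, Prod.fst_sub, Prod.snd_sub]; ring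

theorem eval_const (i j : ℕ) (c : ℤ) : eval i j (const c) = c := by
  simp [eval, const]

theorem eval_nonneg (i j : ℕ) {f : Form} (h : nonneg f) : 0 ≤ eval i j f := by
  simp only [nonneg, Bool.and_eq_true, decide_eq_true_eq] at h
  obtain ⟨⟨h₁, h₂⟩, h₃⟩ := h
  unfold eval
  positivity

theorem eval_ne_zero (i j : ℕ) {f : Form} (h : nonzero f) : eval i j f ≠ 0 := by
  simp only [nonzero, Bool.or_eq_true] at h
  rcases h with h | h <;> have := eval_nonneg i j h <;>
    simp only [eval_sub, eval_neg, eval_const] at this <;> omega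

theorem eval_abs (i j : ℕ) {f : Form} (h : signed f) : eval i j (abs f) = (eval i j f).natAbs := by
  simp only [signed, Bool.or_eq_true] at h
  unfold abs
  split_ifs with hf
  · have := eval_nonneg i j hf
    omega
  · have := eval_nonneg i j (h.resolve_left hf)
    rw [eval_neg] at this ⊢
    omega

end Form

/-- A family of alcoves depending affinely on two parameters. -/
abbrev Fam : Type := Form × Form × Form

namespace Fam

/-- The member of a family at the parameters `(i, j)`. -/
def eval (i j : ℕ) (s : Fam) : Tri := (s.1.eval i j, s.2.1.eval i j, s.2.2.eval i j)

/-- The reflection of a family in a family of mirrors. -/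
def reflect (m : Fin 3) (k : Form) (s : Fam) : Fam :=
  if m = 0 then (-k - s.2.1, -k - s.1, k + k + Form.const 1 - s.2.2)
  else if m = 1 then (k + k + Form.const 1 - s.1, -k - s.2.2, -k - s.2.1)
  else (-k - s.2.2, k + k + Form.const 1 - s.2.1, -k - s.1)

/-- The coordinate of a family in a given direction. -/
def coord (m : Fin 3) (s : Fam) : Form :=
  if m = 0 then s.2.2 else if m = 1 then s.1 else s.2.1

/-- The sizes of the members of a family whose coordinates have constant sign. -/
def size (s : Fam) : Form := s.1.abs + s.2.1.abs + s.2.2.abs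

/-- All the coordinates of `s` have constant sign for evident reasons. -/
def signed (s : Fam) : Bool := s.1.signed && s.2.1.signed && s.2.2.signed

/-- The families `s` and `t` take distinct values everywhere. -/
def apart (s t : Fam) : Bool :=
  (s.1 - t.1).nonzero || (s.2.1 - t.2.1).nonzero || (s.2.2 - t.2.2).nonzero

/-- The amount by which the difference in size between `t` and `s` exceeds one. -/
def excess (s t : Fam) : Form := t.size - s.size - Form.const 1

/-- The mirrors that can possibly give covers of `s`, for the mirrors of direction `i`. -/
def mirrors (i : Fin 3) (s : Fam) : List Form :=
  if (coord i s).nonneg then [coord i s, Form.const (-1)]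
  else if (-coord i s - Form.const 1).nonneg then [Form.const 0, coord i s - Form.const 1]
  else [coord i s, Form.const (-1), Form.const 0, coord i s - Form.const 1]

/-- The reflections of `s` in all the mirrors that can possibly give covers. -/
def reflections (s : Fam) : List Fam :=
  [0, 1, 2].flatMap fun i => (mirrors i s).map fun k => reflect i k s

/-- A list of families containing all the covers of `s`. -/
def covers (s : Fam) : List Fam :=
  (reflections s).filter fun t => !(signed s && signed t && (excess s t).nonzero)

/-- A sufficient condition for `t` to cover `s` everywhere. -/
def isCover (s t : Fam) : Bool :=
  signed s && signed t && decide (excess s t = 0) && decide (t ∈ reflections s)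

theorem eval_reflect (m : Fin 3) (k : Form) (s : Fam) (i j : ℕ) :
    (reflect m k s).eval i j = Tri.reflect m (k.eval i j) (s.eval i j) := by
  match m with
  | 0 | 1 | 2 =>
    simp [eval, reflect, Tri.reflect, Form.eval_add, Form.eval_sub, Form.eval_neg,
      Form.eval_const, two_mul]

theorem eval_coord (m : Fin 3) (s : Fam) (i j : ℕ) :
    (coord m s).eval i j = Tri.coord m (s.eval i j) := by
  fin_cases m <;> rfl

theorem eval_size {s : Fam} (h : signed s) (i j : ℕ) :
    s.size.eval i j = (s.eval i j).size := by
  simp only [signed, Bool.and_eq_true] at h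
  simp only [size, Tri.size, eval, Form.eval_add, Form.eval_abs i j h.1.1,
    Form.eval_abs i j h.1.2, Form.eval_abs i j h.2]
  push_cast
  rfl

theorem eval_excess {s t : Fam} (hs : signed s) (ht : signed t) (i j : ℕ) :
    (excess s t).eval i j = (t.eval i j).size - (s.eval i j).size - 1 := by
  rw [excess, Form.eval_sub, Form.eval_sub, Form.eval_const, eval_size hs, eval_size ht]

theorem eval_ne_of_apart {s t : Fam} (h : apart s t) (i j : ℕ) : s.eval i j ≠ t.eval i j := by
  intro e
  simp only [eval, Prod.mk.injEq] at e
  simp only [apart, Bool.or_eq_true] at h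
  rcases h with (h | h) | h <;> have := Form.eval_ne_zero i j h <;>
    rw [Form.eval_sub] at this <;> omega

theorem exists_mem_covers {s : Fam} {i j : ℕ} {w : Tri} (hs : (s.eval i j).Valid)
    (h : Tri.Cover (s.eval i j) w) : ∃ t ∈ covers s, t.eval i j = w := by
  obtain ⟨m, k, rfl, hk⟩ := h
  have hm : ∃ f ∈ mirrors m s, f.eval i j = k := by
    have := Tri.cover_index hs hk
    rw [← eval_coord] at this
    unfold mirrors
    split_ifs with h₁ h₂
    · have := Form.eval_nonneg i j h₁
      rcases (by omega : k = (coord m s).eval i j ∨ k = -1) with rfl | rfl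
      · exact ⟨coord m s, by simp, rfl⟩
      · exact ⟨Form.const (-1), by simp, Form.eval_const _ _ _⟩
    · have := Form.eval_nonneg i j h₂
      rw [Form.eval_sub, Form.eval_neg, Form.eval_const] at this
      rcases (by omega : k = 0 ∨ k = (coord m s).eval i j - 1) with rfl | rfl
      · exact ⟨Form.const 0, by simp, Form.eval_const _ _ _⟩
      · exact ⟨coord m s - Form.const 1, by simp, by rw [Form.eval_sub, Form.eval_const]⟩
    · rcases this with ⟨-, rfl | rfl⟩ | ⟨-, rfl | rfl⟩
      · exact ⟨coord m s, by simp, rfl⟩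
      · exact ⟨Form.const (-1), by simp, Form.eval_const _ _ _⟩
      · exact ⟨Form.const 0, by simp, Form.eval_const _ _ _⟩
      · exact ⟨coord m s - Form.const 1, by simp, by rw [Form.eval_sub, Form.eval_const]⟩
  obtain ⟨f, hf, rfl⟩ := hm
  rw [← eval_reflect] at hk ⊢
  refine ⟨reflect m f s, List.mem_filter.2 ⟨?_, ?_⟩, rfl⟩
  · exact List.mem_flatMap.2 ⟨m, by fin_cases m <;> simp, List.mem_map.2 ⟨f, hf, rfl⟩⟩
  · simp only [Bool.not_eq_true', Bool.and_eq_false_iff]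
    by_contra! hc
    simp only [ne_eq, Bool.not_eq_false] at hc
    refine Form.eval_ne_zero i j hc.2 ?_
    rw [eval_excess hc.1.1 hc.1.2]
    omega

theorem cover_of_isCover {s t : Fam} (h : isCover s t) (i j : ℕ) :
    Tri.Cover (s.eval i j) (t.eval i j) := by
  simp only [isCover, Bool.and_eq_true, decide_eq_true_eq] at h
  obtain ⟨⟨⟨hs, ht⟩, he⟩, hr⟩ := h
  have := eval_excess hs ht i j
  rw [he, show Form.eval i j 0 = 0 by simp [Form.eval]] at this
  simp only [reflections, List.mem_flatMap, List.mem_map] at hr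
  obtain ⟨m, -, k, -, rfl⟩ := hr
  exact ⟨m, k.eval i j, eval_reflect _ _ _ _ _, by omega⟩

/-- The dominant alcoves `(i + 2, j + 2, σ - i - j - 4)`. -/
def base (σ : ℤ) : Fam := ((1, 0, 2), (0, 1, 2), (-1, -1, σ - 4))

/-- The translate of `base σ` by `ρ`. -/
def top (σ : ℤ) : Fam := ((1, 0, 3), (0, 1, 3), (-1, -1, σ - 6))

/-- A list of families containing all the covers of `s` that may lie two steps below `c`. -/
def between (s c : Fam) : List Fam :=
  ((covers s).filter fun a => ((covers a).flatMap covers).any fun c' => !apart c c').dedup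

/-- Covers of `s` lying two steps below `c`. -/
def surelyBetween (s c : Fam) : List Fam :=
  (covers s).filter fun a => isCover s a && (covers a).any fun b => isCover a b && isCover b c

/-- A list of families containing all those that may lie three steps above `s`, with at least
four covers of `s` in between. -/
def rich (s : Fam) : List Fam :=
  (((covers s).flatMap covers).flatMap covers).filter fun c => decide (4 ≤ (between s c).length)

theorem rich_base_zero : ∀ c ∈ rich (base 0), isCover c (top 0) ∧
    4 ≤ (surelyBetween (base 0) c).length ∧ (surelyBetween (base 0) c).Pairwise (apart · ·) := by
  decide +kernel

theorem rich_base_one : ∀ c ∈ rich (base 1), isCover c (top 1) ∧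
    4 ≤ (surelyBetween (base 1) c).length ∧ (surelyBetween (base 1) c).Pairwise (apart · ·) := by
  decide +kernel

theorem common_cover_zero : ∃ c ∈ rich (base 0), ∃ d ∈ rich (base 0),
    ∀ t ∈ covers c, ∀ u ∈ covers d, apart t u ∨ t = top 0 := by
  decide +kernel

theorem common_cover_one : ∃ c ∈ rich (base 1), ∃ d ∈ rich (base 1),
    ∀ t ∈ covers c, ∀ u ∈ covers d, apart t u ∨ t = top 1 := by
  decide +kernel

end Fam

/-- The element `c` lies three steps above `x` for the relation `r`, with at least four elements
one step above `x` in between. -/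
def Rich {α : Type*} (r : α → α → Prop) (x c : α) : Prop :=
  ∃ f : Fin 4 → α, Function.Injective f ∧ ∀ n, r x (f n) ∧ ∃ b, r (f n) b ∧ r b c

namespace Fam

theorem eval_valid_of_mem_covers {s t : Fam} {i j : ℕ} (hs : (s.eval i j).Valid)
    (h : t ∈ covers s) : (t.eval i j).Valid := by
  simp only [covers, reflections, List.mem_filter, List.mem_flatMap, List.mem_map] at h
  obtain ⟨⟨m, -, k, -, rfl⟩, -⟩ := h
  rw [eval_reflect]
  exact hs.reflect _ _

theorem exists_mem_rich {s : Fam} {i j : ℕ} {c : Tri} (hs : (s.eval i j).Valid)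
    (h : Rich Tri.Cover (s.eval i j) c) : ∃ t ∈ rich s, t.eval i j = c := by
  obtain ⟨f, hf, hc⟩ := h
  have key : ∀ n, ∃ a ∈ covers s, a.eval i j = f n ∧
      ∃ t ∈ (covers a).flatMap covers, t.eval i j = c := by
    intro n
    obtain ⟨h₁, b, h₂, h₃⟩ := hc n
    obtain ⟨a, ha, ea⟩ := exists_mem_covers hs h₁
    have va := eval_valid_of_mem_covers hs ha
    rw [← ea] at h₂
    obtain ⟨b, hb, rfl⟩ := exists_mem_covers va h₂
    obtain ⟨t, ht, et⟩ := exists_mem_covers (eval_valid_of_mem_covers va hb) h₃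
    exact ⟨a, ha, ea, t, List.mem_flatMap.2 ⟨b, hb, ht⟩, et⟩
  choose a ha ea t ht et using key
  refine ⟨t 0, List.mem_filter.2 ⟨?_, decide_eq_true ?_⟩, et 0⟩
  · obtain ⟨b, hb, hb'⟩ := List.mem_flatMap.1 (ht 0)
    exact List.mem_flatMap.2 ⟨b, List.mem_flatMap.2 ⟨_, ha 0, hb⟩, hb'⟩
  · have inj : Function.Injective a := fun m n e => hf (by rw [← ea, ← ea, e])
    have hmem : ∀ n, a n ∈ between s (t 0) := by
      intro n
      refine List.mem_dedup.2 (List.mem_filter.2 ⟨ha n, List.any_eq_true.2 ⟨t n, ht n, ?_⟩⟩)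
      by_contra hap
      exact eval_ne_of_apart (by simpa using hap) i j ((et 0).trans (et n).symm)
    calc 4 = (Finset.univ.image a).card := by
          rw [Finset.card_image_of_injective _ inj, Finset.card_univ, Fintype.card_fin]
      _ ≤ (between s (t 0)).toFinset.card := Finset.card_le_card (by
          intro b hb
          obtain ⟨n, -, rfl⟩ := Finset.mem_image.1 hb
          exact List.mem_toFinset.2 (hmem n))
      _ ≤ _ := List.toFinset_card_le _

theorem rich_of_surelyBetween {s c : Fam} (h₄ : 4 ≤ (surelyBetween s c).length)
    (h : (surelyBetween s c).Pairwise (apart · ·)) (i j : ℕ) :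
    Rich Tri.Cover (s.eval i j) (c.eval i j) := by
  have hlt : ∀ n : Fin 4, n.1 < (surelyBetween s c).length := fun n => n.2.trans_le h₄
  refine ⟨fun n => ((surelyBetween s c)[n.1]'(hlt n)).eval i j, ?_, fun n => ?_⟩
  · intro m n e
    by_contra hne
    rcases lt_or_gt_of_ne hne with hl | hl
    · exact eval_ne_of_apart (List.pairwise_iff_getElem.1 h _ _ (hlt m) (hlt n) hl) i j e
    · exact eval_ne_of_apart (List.pairwise_iff_getElem.1 h _ _ (hlt n) (hlt m) hl) i j e.symm
  · have := List.getElem_mem (hlt n)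
    simp only [surelyBetween, List.mem_filter, Bool.and_eq_true, List.any_eq_true] at this
    obtain ⟨-, h₁, b, -, h₂, h₃⟩ := this
    exact ⟨cover_of_isCover h₁ i j, b.eval i j, cover_of_isCover h₂ i j,
      cover_of_isCover h₃ i j⟩

theorem cover_top {s t : Fam} {i j : ℕ} (hs : (s.eval i j).Valid)
    (hr : ∀ c ∈ rich s, isCover c t) {c : Tri}
    (h : Rich Tri.Cover (s.eval i j) c) : Tri.Cover c (t.eval i j) := by
  obtain ⟨c, hc, rfl⟩ := exists_mem_rich hs h
  exact cover_of_isCover (hr c hc) i j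

end Fam

namespace Tri

/-- Translation by `ρ`. -/
def addRho (z : Tri) : Tri := (z.1 + 1, z.2.1 + 1, z.2.2 - 2)

theorem exists_eval_base {x : Tri} (hx : x.Valid) (h₁ : 2 ≤ x.1) (h₂ : 2 ≤ x.2.1) :
    ∃ i j, ∃ σ, (σ = 0 ∨ σ = 1) ∧ x = (Fam.base σ).eval i j ∧ addRho x = (Fam.top σ).eval i j := by
  obtain ⟨p, q, r⟩ := x
  refine ⟨(p - 2).toNat, (q - 2).toNat, p + q + r, hx, ?_, ?_⟩ <;>
    simp only [Valid, Fam.eval, Fam.base, Fam.top, Form.eval, addRho, Prod.mk.injEq] at * <;> omega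

theorem cover_addRho_of_rich {x c : Tri} (hx : x.Valid) (h₁ : 2 ≤ x.1) (h₂ : 2 ≤ x.2.1)
    (h : Rich Cover x c) : Cover c (addRho x) := by
  obtain ⟨i, j, σ, hσ, e, e'⟩ := exists_eval_base hx h₁ h₂
  rw [e']
  rw [e] at h hx
  rcases hσ with rfl | rfl
  · exact Fam.cover_top hx (fun c hc => (Fam.rich_base_zero c hc).1) h
  · exact Fam.cover_top hx (fun c hc => (Fam.rich_base_one c hc).1) h

theorem eq_addRho {x z : Tri} (hx : x.Valid) (h₁ : 2 ≤ x.1) (h₂ : 2 ≤ x.2.1)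
    (h : ∀ c, Rich Cover x c → Cover c z) : z = addRho x := by
  obtain ⟨i, j, σ, hσ, e, e'⟩ := exists_eval_base hx h₁ h₂
  rw [e']
  rw [e] at h hx
  have key : ∀ s t : Fam, (s.eval i j).Valid →
      (∀ c ∈ Fam.rich s, Fam.isCover c t ∧ 4 ≤ (Fam.surelyBetween s c).length ∧
        (Fam.surelyBetween s c).Pairwise (Fam.apart · ·)) →
      (∃ c ∈ Fam.rich s, ∃ d ∈ Fam.rich s,
        ∀ t' ∈ Fam.covers c, ∀ u ∈ Fam.covers d, Fam.apart t' u ∨ t' = t) →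
      (∀ c, Rich Cover (s.eval i j) c → Cover c z) → z = t.eval i j := by
    intro s t hs hr hc h
    obtain ⟨c, hc, d, hd, hcd⟩ := hc
    have valid : ∀ c ∈ Fam.rich s, (c.eval i j).Valid := by
      intro c hc
      obtain ⟨b, hb, hc⟩ := List.mem_flatMap.1 (List.mem_filter.1 hc).1
      obtain ⟨a, ha, hb⟩ := List.mem_flatMap.1 hb
      exact Fam.eval_valid_of_mem_covers (Fam.eval_valid_of_mem_covers
        (Fam.eval_valid_of_mem_covers hs ha) hb) hc
    obtain ⟨t', ht, et⟩ := Fam.exists_mem_covers (valid c hc)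
      (h _ (Fam.rich_of_surelyBetween (hr c hc).2.1 (hr c hc).2.2 i j))
    obtain ⟨u, hu, eu⟩ := Fam.exists_mem_covers (valid d hd)
      (h _ (Fam.rich_of_surelyBetween (hr d hd).2.1 (hr d hd).2.2 i j))
    rcases hcd t' ht u hu with ha | rfl
    · exact absurd (et.trans eu.symm) (Fam.eval_ne_of_apart ha i j)
    · exact et.symm
  rcases hσ with rfl | rfl
  · exact key _ _ hx Fam.rich_base_zero Fam.common_cover_zero h
  · exact key _ _ hx Fam.rich_base_one Fam.common_cover_one h

end Tri

/-- An isomorphism between intervals preserves an element characterised by covering all rich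
elements of the interval. -/
theorem apply_eq_of_rich {α : Type*} {le U : α → α → Prop} {len : α → ℕ}
    (hrefl : ∀ a, le a a) (htrans : ∀ a b c, le a b → le b c → le a c)
    (hlen : ∀ a b, le a b → a = b ∨ len a < len b)
    (hU : ∀ a b, U a b ↔ le a b ∧ len b = len a + 1)
    (hchain : ∀ a b, le a b → a = b ∨ ∃ c, U a c ∧ le c b)
    {x y x' y' T T' : α} (hT' : le T' y')
    (φ : {z : α // le x z ∧ le z y} ≃ {z : α // le x' z ∧ le z y'})
    (hφ : ∀ u v, le u.1 v.1 ↔ le (φ u).1 (φ v).1)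
    (h₁ : ∀ c, Rich U x c → U c T) (h₂ : ∀ c, Rich U x' c → U c T')
    (h₃ : ∀ z, (∀ c, Rich U x' c → U c z) → z = T')
    (h : le x T ∧ le T y) : (φ ⟨T, h⟩).1 = T' := by
  have anti : ∀ a b, le a b → le b a → a = b := by
    intro a b hab hba
    rcases hlen a b hab with h | h
    · exact h
    · rcases hlen b a hba with h' | h'
      · exact h'.symm
      · omega
  have Ule : ∀ {a b}, U a b → le a b := fun h => ((hU _ _).1 h).1
  have covBy : ∀ a b, U a b ↔ le a b ∧ a ≠ b ∧ ∀ c, le a c → le c b → c = a ∨ c = b := by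
    intro a b
    rw [hU]
    constructor
    · rintro ⟨hab, hl⟩
      refine ⟨hab, by rintro rfl; omega, fun c hac hcb => ?_⟩
      rcases hlen _ _ hac with h | h
      · exact .inl h.symm
      · rcases hlen _ _ hcb with h' | h'
        · exact .inr h'
        · omega
    · rintro ⟨hab, hne, hc⟩
      obtain ⟨c, hac, hcb⟩ := (hchain a b hab).resolve_left hne
      have hl := (hU a c).1 hac
      rcases hc c hl.1 hcb with rfl | rfl
      · omega
      · exact hl
  have hxy : le x y := htrans _ _ _ h.1 h.2
  have hxy' : le x' y' := htrans _ _ _ (φ ⟨T, h⟩).2.1 (φ ⟨T, h⟩).2.2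
  have bot : (φ ⟨x, hrefl x, hxy⟩).1 = x' := by
    refine anti _ _ ?_ (φ ⟨x, hrefl x, hxy⟩).2.1
    have := (hφ ⟨x, hrefl x, hxy⟩ (φ.symm ⟨x', hrefl x', hxy'⟩)).1 (φ.symm _).2.1
    rwa [φ.apply_symm_apply] at this
  have cov : ∀ u v, U u.1 v.1 ↔ U (φ u).1 (φ v).1 := by
    intro u v
    rw [covBy, covBy, hφ, Ne, Ne, ← Subtype.ext_iff, ← Subtype.ext_iff, φ.apply_eq_iff_eq]
    refine and_congr_right fun _ => and_congr_right fun _ => ⟨fun H c huc hcv => ?_,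
      fun H c huc hcv => ?_⟩
    · obtain ⟨d, hd⟩ := φ.surjective
        ⟨c, htrans _ _ _ (φ u).2.1 huc, htrans _ _ _ hcv (φ v).2.2⟩
      obtain rfl : (φ d).1 = c := by rw [hd]
      rw [← hφ] at huc hcv
      rcases H d.1 huc hcv with e | e
      · exact .inl (by rw [Subtype.ext e])
      · exact .inr (by rw [Subtype.ext e])
    · have := H (φ ⟨c, htrans _ _ _ u.2.1 huc, htrans _ _ _ hcv v.2.2⟩).1
        ((hφ _ _).1 huc) ((hφ _ _).1 hcv)
      rw [← Subtype.ext_iff, ← Subtype.ext_iff, φ.apply_eq_iff_eq, φ.apply_eq_iff_eq] at this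
      exact this.imp (congrArg Subtype.val) (congrArg Subtype.val)
  refine h₃ _ fun c hc => ?_
  have hcT := Ule (h₂ c hc)
  obtain ⟨f, hf, hfc⟩ := hc
  have hxc : le x' c := by
    obtain ⟨h0, b, h0b, hbc⟩ := hfc 0
    exact htrans _ _ _ (Ule h0) (htrans _ _ _ (Ule h0b) (Ule hbc))
  have hcy := htrans _ _ _ hcT hT'
  obtain ⟨d, hd⟩ := φ.surjective ⟨c, hxc, hcy⟩
  obtain rfl : (φ d).1 = c := by rw [hd]
  refine (cov d ⟨T, h⟩).1 (h₁ _ ?_)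
  have lift : ∀ b, le x' b → le b (φ d).1 → ∃ a, (φ a).1 = b := fun b h h' =>
    ⟨φ.symm ⟨b, h, htrans _ _ _ h' hcy⟩, by rw [φ.apply_symm_apply]⟩
  have key : ∀ n, ∃ a, (φ a).1 = f n ∧ U x a.1 ∧ ∃ b, U a.1 b ∧ U b d.1 := by
    intro n
    obtain ⟨h0, b, h0b, hbc⟩ := hfc n
    obtain ⟨a, ha⟩ := lift (f n) (Ule h0) (htrans _ _ _ (Ule h0b) (Ule hbc))
    obtain ⟨b, rfl⟩ := lift b (htrans _ _ _ (Ule h0) (Ule h0b)) (Ule hbc)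
    rw [← ha, ← cov] at h0b
    rw [← ha] at h0
    exact ⟨a, ha, (cov ⟨x, hrefl x, hxy⟩ a).2 (bot.symm ▸ h0), b.1, h0b, (cov _ _).2 hbc⟩
  choose g hg hg' using key
  refine ⟨fun n => (g n).1, fun m n e => hf ?_, hg'⟩
  rw [← hg, ← hg, Subtype.ext e]

namespace Tri

/-- The order generated by the reflections increasing the size. -/
def Reach (z w : Tri) : Prop := Relation.ReflTransGen Step z w

theorem Reach.trans {u v w : Tri} (h : Reach u v) (h' : Reach v w) : Reach u w :=
  Relation.ReflTransGen.trans h h'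

theorem Reach.refl (z : Tri) : Reach z z := Relation.ReflTransGen.refl

theorem Reach.of_eq {z w w' : Tri} (h : Reach z w) (e : w = w') : Reach z w' := e ▸ h

theorem reach_up (A B : ℤ) (hA : 1 ≤ A) (hB : 1 ≤ B) :
    Reach (A, B, 1 - A - B) (A, B, -A - B) := by
  refine .single ⟨0, -A - B, ?_, ?_⟩ <;>
    simp only [Tri.reflect, size, Prod.mk.injEq] <;> omega

theorem reach_succ_left_up (A B : ℤ) (hA : 1 ≤ A) (hB : 1 ≤ B) :
    Reach (A, B, -A - B) (A + 1, B, -A - B) := by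
  refine .single ⟨1, A, ?_, ?_⟩ <;>
    simp only [Tri.reflect, size, Prod.mk.injEq, and_true] <;> omega

theorem reach_succ_right_up (A B : ℤ) (hA : 1 ≤ A) (hB : 1 ≤ B) :
    Reach (A, B, -A - B) (A, B + 1, -A - B) := by
  refine .single ⟨2, B, ?_, ?_⟩ <;>
    simp only [Tri.reflect, size, Prod.mk.injEq] <;> omega

theorem reach_add_left (A B : ℤ) (hA : 1 ≤ A) (hB : 1 ≤ B) (n : ℕ) :
    Reach (A, B, -A - B) (A + n, B, -(A + n) - B) := by
  induction n with
  | zero => simpa using Reach.refl _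
  | succ n ih =>
    refine (ih.trans (reach_succ_left_up (A + n) B (by omega) hB)).trans ?_
    rw [show -(A + (n : ℤ)) - B = 1 - (A + n + 1) - B by ring]
    exact (reach_up (A + n + 1) B (by omega) hB).of_eq
      (by simp only [Prod.mk.injEq, true_and]; push_cast; omega)

theorem reach_add_right (A B : ℤ) (hA : 1 ≤ A) (hB : 1 ≤ B) (n : ℕ) :
    Reach (A, B, -A - B) (A, B + n, -A - (B + n)) := by
  induction n with
  | zero => simpa using Reach.refl _
  | succ n ih =>
    refine (ih.trans (reach_succ_right_up A (B + n) hA (by omega))).trans ?_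
    rw [show -A - (B + (n : ℤ)) = 1 - A - (B + n + 1) by ring]
    exact (reach_up A (B + n + 1) hA (by omega)).of_eq
      (by simp only [Prod.mk.injEq, true_and]; push_cast; omega)

theorem reach_add_left_sub_right (A B : ℤ) (hA : 1 ≤ A) (n : ℕ) (hB : n + 1 ≤ B) :
    Reach (A, B, -A - B) (A + 2 * n, B - n, -(A + 2 * n) - (B - n)) := by
  induction n with
  | zero => simpa using Reach.refl _
  | succ n ih =>
    push_cast at hB
    refine ((ih (by omega)).trans
      (reach_succ_left_up (A + 2 * n) (B - n) (by omega) (by omega))).tail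
      ⟨1, A + 2 * n + 1, ?_, ?_⟩ <;>
    simp only [Tri.reflect, size, Prod.mk.injEq] <;> push_cast <;> omega

theorem reach_add_right_sub_left (A B : ℤ) (hB : 1 ≤ B) (n : ℕ) (hA : n + 1 ≤ A) :
    Reach (A, B, -A - B) (A - n, B + 2 * n, -(A - n) - (B + 2 * n)) := by
  induction n with
  | zero => simpa using Reach.refl _
  | succ n ih =>
    push_cast at hA
    refine ((ih (by omega)).trans
      (reach_succ_right_up (A - n) (B + 2 * n) (by omega) (by omega))).tail
      ⟨2, B + 2 * n + 1, ?_, ?_⟩ <;>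
    simp only [Tri.reflect, size, Prod.mk.injEq] <;> push_cast <;> omega

theorem reach_of_le {A B C D : ℤ} (hA : 1 ≤ A) (hB : 1 ≤ B) (hC : 1 ≤ C) (hD : 1 ≤ D)
    (h₁ : 2 * A + B ≤ 2 * C + D) (h₂ : A + 2 * B ≤ C + 2 * D) :
    Reach (A, B, -A - B) (C, D, -C - D) := by
  rcases lt_or_ge D B with h | h
  · obtain ⟨n, hn⟩ := Int.eq_ofNat_of_zero_le (a := B - D) (by omega)
    obtain ⟨m, hm⟩ := Int.eq_ofNat_of_zero_le (a := C - A - 2 * n) (by omega)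
    have := (reach_add_left_sub_right A B hA n (by omega)).trans
      (reach_add_left (A + 2 * n) (B - n) (by omega) (by omega) m)
    exact this.of_eq (by simp only [Prod.mk.injEq]; omega)
  rcases lt_or_ge C A with h' | h'
  · obtain ⟨n, hn⟩ := Int.eq_ofNat_of_zero_le (a := A - C) (by omega)
    obtain ⟨m, hm⟩ := Int.eq_ofNat_of_zero_le (a := D - B - 2 * n) (by omega)
    have := (reach_add_right_sub_left A B hB n (by omega)).trans
      (reach_add_right (A - n) (B + 2 * n) (by omega) (by omega) m)
    exact this.of_eq (by simp only [Prod.mk.injEq]; omega)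
  · obtain ⟨n, hn⟩ := Int.eq_ofNat_of_zero_le (a := C - A) (by omega)
    obtain ⟨m, hm⟩ := Int.eq_ofNat_of_zero_le (a := D - B) (by omega)
    have := (reach_add_left A B hA hB n).trans (reach_add_right (A + n) B (by omega) hB m)
    exact this.of_eq (by simp only [Prod.mk.injEq]; omega)

theorem reach_addRho {x y : Tri} (hx : x.Valid) (hy : y.Valid) (hx₁ : 1 ≤ x.1) (hx₂ : 1 ≤ x.2.1)
    (hy₁ : 2 ≤ y.1) (hy₂ : 1 ≤ y.2.1) (h₁ : x.1 - x.2.2 + 6 ≤ y.1 - y.2.2)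
    (h₂ : x.2.1 - x.2.2 + 6 ≤ y.2.1 - y.2.2) : Reach (addRho x) y := by
  obtain ⟨p, q, r⟩ := x
  obtain ⟨C, D, E⟩ := y
  simp only [Valid] at *
  have start : Reach (addRho (p, q, r)) (p + 1, q + 1, -(p + 1) - (q + 1)) := by
    rcases hx with h | h
    · exact (Reach.refl _).of_eq (by simp only [addRho, Prod.mk.injEq, true_and]; omega)
    · rw [show addRho (p, q, r) = (p + 1, q + 1, 1 - (p + 1) - (q + 1)) by
        simp only [addRho, Prod.mk.injEq, true_and]; omega]
      exact reach_up (p + 1) (q + 1) (by omega) (by omega)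
  refine start.trans ?_
  rcases hy with h | h
  · exact (reach_of_le (C := C) (D := D) (by omega) (by omega) (by omega) (by omega) (by omega)
      (by omega)).of_eq (by simp only [Prod.mk.injEq, true_and]; omega)
  · exact ((reach_of_le (C := C - 1) (D := D) (by omega) (by omega) (by omega) (by omega)
      (by omega) (by omega)).trans (reach_succ_left_up (C - 1) D (by omega) (by omega))).of_eq
        (by simp only [Prod.mk.injEq, true_and]; omega)

theorem Reach.width_le {z w : Tri} (hz : z.Valid) (h : Reach z w) :
    width₁ z ≤ width₁ w ∧ width₂ z ≤ width₂ w := by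
  have : w.Valid ∧ width₁ z ≤ width₁ w ∧ width₂ z ≤ width₂ w := by
    induction h with
    | refl => exact ⟨hz, le_rfl, le_rfl⟩
    | tail _ hs ih =>
      have := hs.width_le ih.1
      exact ⟨hs.valid ih.1, ih.2.1.trans this.1, ih.2.2.trans this.2⟩
  exact this.2

end Tri

/-- Coordinates of the elements of a Coxeter group of type affine `A₂`, on which left
multiplication by the simple reflections acts by `Tri.reflect`. -/
structure IsCoord {W : Type*} [Group W] {M : CoxeterMatrix (Fin 3)} (cs : CoxeterSystem M W)
    (co : W → Tri) : Prop where
  valid : ∀ w, (co w).Valid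
  injective : Function.Injective co
  one : co 1 = (0, 0, 0)
  simple_mul : ∀ i w, co (cs.simple i * w) = Tri.reflect i 0 (co w)

theorem Tri.reflect_conj_self (i : Fin 3) (k : ℤ) (z : Tri) :
    Tri.reflect i 0 (Tri.reflect i k (Tri.reflect i 0 z)) = Tri.reflect i (-k) z := by
  obtain ⟨p, q, r⟩ := z
  fin_cases i <;> simp only [Tri.reflect, Prod.mk.injEq] <;> omega

theorem Tri.reflect_conj (i j l : Fin 3) (hij : i ≠ j) (hil : i ≠ l) (hjl : j ≠ l) (k : ℤ)
    (z : Tri) : Tri.reflect j 0 (Tri.reflect i k (Tri.reflect j 0 z)) =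
      Tri.reflect l (-k - 1) z := by
  obtain ⟨p, q, r⟩ := z
  fin_cases i <;> fin_cases j <;> fin_cases l <;> simp at hij hil hjl <;>
    simp only [Tri.reflect, Prod.mk.injEq] <;> omega

namespace IsCoord

variable {W : Type*} [Group W] {M : CoxeterMatrix (Fin 3)} {cs : CoxeterSystem M W} {co : W → Tri}

theorem length_eq (h : IsCoord cs co) (w : W) : cs.length w = (co w).size := by
  apply le_antisymm
  · induction hn : (co w).size using Nat.strong_induction_on generalizing w with
    | _ n ih =>
      subst hn
      by_cases h0 : co w = (0, 0, 0)
      · rw [h.injective (h0.trans h.one.symm)]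
        simp
      · obtain ⟨i, hi⟩ := Tri.exists_descent (h.valid w) h0
        rw [← h.simple_mul] at hi
        have := ih _ (by omega) (cs.simple i * w) rfl
        have := cs.length_simple_mul w i
        omega
  · obtain ⟨ω, hω, rfl⟩ := cs.exists_isReduced w
    rw [hω.eq]
    clear hω
    induction ω with
    | nil => simp [h.one, Tri.size]
    | cons i ω ih =>
      rw [cs.wordProd_cons, h.simple_mul, List.length_cons]
      have := Tri.size_simple i (h.valid (cs.wordProd ω))
      omega

theorem reflect_mul_simple (h : IsCoord cs co) {t : W} {i : Fin 3} {k : ℤ}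
    (ht : ∀ a, co (t * a) = Tri.reflect i k (co a)) (j : Fin 3) (a : W) :
    co (cs.simple j * t * (cs.simple j)⁻¹ * a) =
      Tri.reflect j 0 (Tri.reflect i k (Tri.reflect j 0 (co a))) := by
  rw [cs.inv_simple, mul_assoc, mul_assoc, h.simple_mul, ht, h.simple_mul]

theorem exists_reflect (h : IsCoord cs co) {t : W} (ht : cs.IsReflection t) :
    ∃ i k, ∀ a, co (t * a) = Tri.reflect i k (co a) := by
  have exists_third : ∀ l j : Fin 3, l ≠ j → ∃ m, l ≠ m ∧ j ≠ m := by decide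
  obtain ⟨w, i, rfl⟩ := ht
  induction w using cs.simple_induction_left with
  | one => exact ⟨i, 0, fun a => by simpa using h.simple_mul i a⟩
  | mul_simple_left w j ih =>
    obtain ⟨l, k, hk⟩ := ih
    have key := h.reflect_mul_simple hk j
    rw [show cs.simple j * (w * cs.simple i * w⁻¹) * (cs.simple j)⁻¹ =
      cs.simple j * w * cs.simple i * (cs.simple j * w)⁻¹ by group] at key
    by_cases hlj : l = j
    · subst hlj
      exact ⟨l, -k, fun a => by rw [key, Tri.reflect_conj_self]⟩
    · obtain ⟨m, hm⟩ := exists_third l j hlj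
      exact ⟨m, -k - 1, fun a => by rw [key, Tri.reflect_conj l j m hlj hm.1 hm.2]⟩

theorem exists_isReflection (h : IsCoord cs co) (i : Fin 3) (k : ℤ) :
    ∃ t, cs.IsReflection t ∧ ∀ a, co (t * a) = Tri.reflect i k (co a) := by
  have key : ∀ n : ℕ, ∀ i, (∃ t, cs.IsReflection t ∧ ∀ a, co (t * a) = Tri.reflect i n (co a)) ∧
      ∃ t, cs.IsReflection t ∧ ∀ a, co (t * a) = Tri.reflect i (-n) (co a) := by
    intro n
    induction n with
    | zero =>
      intro i
      have : ∃ t, cs.IsReflection t ∧ ∀ a, co (t * a) = Tri.reflect i 0 (co a) :=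
        ⟨_, cs.isReflection_simple i, h.simple_mul i⟩
      simpa using this
    | succ n ih =>
      have neg : ∀ i, ∃ t, cs.IsReflection t ∧
          ∀ a, co (t * a) = Tri.reflect i (-(n + 1 : ℕ)) (co a) := by
        intro i
        obtain ⟨j, l, hjl, hji, hli⟩ : ∃ j l : Fin 3, j ≠ l ∧ j ≠ i ∧ l ≠ i := by
          revert i; decide
        obtain ⟨t, ht, hk⟩ := (ih j).1
        refine ⟨_, ht.conj (cs.simple l), fun a => ?_⟩
        rw [h.reflect_mul_simple hk, Tri.reflect_conj j l i hjl hji hli]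
        push_cast
        ring_nf
      intro i
      refine ⟨?_, neg i⟩
      obtain ⟨t, ht, hk⟩ := neg i
      refine ⟨_, ht.conj (cs.simple i), fun a => ?_⟩
      rw [h.reflect_mul_simple hk, Tri.reflect_conj_self, neg_neg]
  rcases Int.eq_nat_or_neg k with ⟨n, rfl | rfl⟩
  · exact (key n i).1
  · exact (key n i).2

theorem step_iff (h : IsCoord cs co) (a b : W) :
    ((∃ t, cs.IsReflection t ∧ b = t * a) ∧ cs.length a < cs.length b) ↔
      Tri.Step (co a) (co b) := by
  rw [h.length_eq, h.length_eq]
  constructor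
  · rintro ⟨⟨t, ht, rfl⟩, hl⟩
    obtain ⟨i, k, hk⟩ := h.exists_reflect ht
    exact ⟨i, k, hk a, hl⟩
  · rintro ⟨i, k, hb, hl⟩
    obtain ⟨t, ht, hk⟩ := h.exists_isReflection i k
    exact ⟨⟨t, ht, h.injective (hb.trans (hk a).symm)⟩, hl⟩

theorem exists_of_step (h : IsCoord cs co) {a : W} {z : Tri} (hz : Tri.Step (co a) z) :
    ∃ b, co b = z := by
  obtain ⟨i, k, rfl, -⟩ := hz
  obtain ⟨t, -, ht⟩ := h.exists_isReflection i k
  exact ⟨t * a, ht a⟩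

theorem bruhatLE_of_reach (h : IsCoord cs co) {a b : W} (hab : Tri.Reach (co a) (co b)) :
    bruhatLE cs a b := by
  have key : ∀ z, Tri.Reach (co a) z → ∃ c, co c = z ∧ bruhatLE cs a c := by
    intro z hz
    induction hz with
    | refl => exact ⟨a, rfl, .inl rfl⟩
    | tail _ hs ih =>
      obtain ⟨c, rfl, hc⟩ := ih
      obtain ⟨d, rfl⟩ := h.exists_of_step hs
      have hs := (h.step_iff c d).2 hs
      refine ⟨d, rfl, .inr ?_⟩
      rcases hc with rfl | hc
      · exact .single hs
      · exact hc.tail hs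
  obtain ⟨c, hc, hac⟩ := key _ hab
  rwa [← h.injective hc]

theorem bruhatLE_iff (h : IsCoord cs co) {a b : W} :
    bruhatLE cs a b ↔ Tri.Reach (co a) (co b) := by
  refine ⟨?_, h.bruhatLE_of_reach⟩
  rintro (rfl | hab)
  · exact .refl _
  · exact hab.to_reflTransGen.lift co fun _ _ => (h.step_iff _ _).1

theorem eq_or_length_lt {a b : W} (hab : bruhatLE cs a b) :
    a = b ∨ cs.length a < cs.length b := by
  refine hab.imp_right fun hlt => ?_
  induction hlt with
  | single hs => exact hs.2
  | tail _ hs ih => exact (ih (.inr ‹_›)).trans hs.2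

theorem mem_Uset (cs : CoxeterSystem M W) (a b : W) :
    b ∈ Uset cs a ↔ bruhatLE cs a b ∧ cs.length b = cs.length a + 1 := by
  refine ⟨fun hab => ⟨.inr hab.1, hab.2⟩, ?_⟩
  rintro ⟨rfl | hab, hl⟩
  · omega
  · exact ⟨hab, hl⟩

theorem bruhatLE_trans {a b c : W} (hab : bruhatLE cs a b) (hbc : bruhatLE cs b c) :
    bruhatLE cs a c := by
  rcases hab with rfl | hab
  · exact hbc
  rcases hbc with rfl | hbc
  · exact .inr hab
  · exact .inr (hab.trans hbc)

theorem mem_Uset_iff_cover (h : IsCoord cs co) (a b : W) :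
    b ∈ Uset cs a ↔ Tri.Cover (co a) (co b) := by
  constructor
  · rintro ⟨hab, hl⟩
    obtain ⟨c, hac, hcb⟩ := Relation.TransGen.head'_iff.1 hab
    have hcb : bruhatLE cs c b := Relation.reflTransGen_iff_eq_or_transGen.1 hcb |>.imp_left .symm
    obtain rfl : c = b := by
      rcases eq_or_length_lt hcb with e | hlt
      · exact e
      · have := hac.2
        omega
    obtain ⟨i, k, hk, -⟩ := (h.step_iff _ _).1 hac
    rw [h.length_eq, h.length_eq] at hl
    exact ⟨i, k, hk, hl⟩
  · rintro ⟨i, k, hk, hl⟩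
    refine ⟨.single ((h.step_iff _ _).2 ⟨i, k, hk, by omega⟩), ?_⟩
    rw [h.length_eq, h.length_eq, hl]

theorem exists_of_cover (h : IsCoord cs co) {a : W} {z : Tri} (hz : Tri.Cover (co a) z) :
    ∃ b ∈ Uset cs a, co b = z := by
  obtain ⟨b, rfl⟩ : ∃ b, co b = z := by
    obtain ⟨i, k, hk, hl⟩ := hz
    exact h.exists_of_step ⟨i, k, hk, by omega⟩
  exact ⟨b, (h.mem_Uset_iff_cover a b).2 hz, rfl⟩

theorem exists_mem_Uset (h : IsCoord cs co) {a b : W} (hab : bruhatLE cs a b) :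
    a = b ∨ ∃ c ∈ Uset cs a, bruhatLE cs c b := by
  refine hab.imp_right fun hlt => ?_
  obtain ⟨d, had, hdb⟩ := Relation.TransGen.head'_iff.1 hlt
  have hdb : bruhatLE cs d b := Relation.reflTransGen_iff_eq_or_transGen.1 hdb |>.imp_left .symm
  obtain ⟨z, hz, hzd⟩ := ((h.step_iff _ _).1 had).exists_cover (h.valid a)
  obtain ⟨c, hc, rfl⟩ := h.exists_of_cover hz
  exact ⟨c, hc, bruhatLE_trans (h.bruhatLE_of_reach hzd) hdb⟩

theorem rich_cover (h : IsCoord cs co) {x c : W} (hc : Rich (fun a b => b ∈ Uset cs a) x c) :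
    Rich Tri.Cover (co x) (co c) := by
  obtain ⟨f, hf, hfc⟩ := hc
  refine ⟨fun n => co (f n), h.injective.comp hf, fun n => ?_⟩
  obtain ⟨h₁, b, h₂, h₃⟩ := hfc n
  exact ⟨(h.mem_Uset_iff_cover _ _).1 h₁, co b, (h.mem_Uset_iff_cover _ _).1 h₂,
    (h.mem_Uset_iff_cover _ _).1 h₃⟩

theorem exists_rich (h : IsCoord cs co) {x : W} {z : Tri} (hz : Rich Tri.Cover (co x) z) :
    ∃ c, Rich (fun a b => b ∈ Uset cs a) x c ∧ co c = z := by
  obtain ⟨f, hf, hfc⟩ := hz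
  have key : ∀ n, ∃ a, co a = f n ∧ a ∈ Uset cs x ∧
      ∃ b ∈ Uset cs a, ∃ c ∈ Uset cs b, co c = z := by
    intro n
    obtain ⟨h₁, b, h₂, h₃⟩ := hfc n
    obtain ⟨a, ha, ea⟩ := h.exists_of_cover h₁
    rw [← ea] at h₂
    obtain ⟨b, hb, rfl⟩ := h.exists_of_cover h₂
    exact ⟨a, ea, ha, b, hb, h.exists_of_cover h₃⟩
  choose g hg hgx b hb c hc hcz using key
  refine ⟨c 0, ⟨g, fun m n e => hf (by rw [← hg, ← hg, e]), fun n => ⟨hgx n, b n, hb n, ?_⟩⟩, hcz 0⟩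
  rw [h.injective ((hcz 0).trans (hcz n).symm)]
  exact hc n

theorem apply_eq_addRho (h : IsCoord cs co) {x y x' y' T T' : W}
    (hx : 2 ≤ (co x).1 ∧ 2 ≤ (co x).2.1) (hx' : 2 ≤ (co x').1 ∧ 2 ≤ (co x').2.1)
    (hT : co T = Tri.addRho (co x)) (hT' : co T' = Tri.addRho (co x')) (hTy : bruhatLE cs T' y')
    (φ : {z : W // bruhatLE cs x z ∧ bruhatLE cs z y} ≃
      {z : W // bruhatLE cs x' z ∧ bruhatLE cs z y'})
    (hφ : ∀ u v, bruhatLE cs u.1 v.1 ↔ bruhatLE cs (φ u).1 (φ v).1)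
    (hxT : bruhatLE cs x T ∧ bruhatLE cs T y) : (φ ⟨T, hxT⟩).1 = T' := by
  refine apply_eq_of_rich (le := bruhatLE cs) (U := fun a b => b ∈ Uset cs a) (len := cs.length)
    (fun _ => Or.inl rfl) (fun _ _ _ => bruhatLE_trans) (fun _ _ => eq_or_length_lt) (mem_Uset cs)
    (fun _ _ => h.exists_mem_Uset) hTy φ hφ (fun c hc => ?_) (fun c hc => ?_) (fun z hz => ?_) hxT
  · rw [h.mem_Uset_iff_cover, hT]
    exact Tri.cover_addRho_of_rich (h.valid x) hx.1 hx.2 (h.rich_cover hc)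
  · rw [h.mem_Uset_iff_cover, hT']
    exact Tri.cover_addRho_of_rich (h.valid x') hx'.1 hx'.2 (h.rich_cover hc)
  · refine h.injective ?_
    rw [hT']
    refine Tri.eq_addRho (h.valid x') hx'.1 hx'.2 fun c hc => ?_
    obtain ⟨d, hd, rfl⟩ := h.exists_rich hc
    exact (h.mem_Uset_iff_cover _ _).1 (hz d hd)

end IsCoord

/-- The barycenter of the alcove with given coordinates. -/
def Tri.bary (z : Tri) : E2 :=
  (((z.1 - z.2.2 - 1 : ℤ) : ℝ) / 3, ((z.2.1 - z.2.2 - 1 : ℤ) : ℝ) / 3)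

theorem Tri.bary_injective {z w : Tri} (hz : z.Valid) (hw : w.Valid) (h : bary z = bary w) :
    z = w := by
  obtain ⟨p, q, r⟩ := z
  obtain ⟨p', q', r'⟩ := w
  simp only [bary, Prod.mk.injEq, div_left_inj' (three_ne_zero' ℝ), Int.cast_inj] at h
  simp only [Valid, Prod.mk.injEq] at *
  omega

theorem exists_isCoord {W : Type*} [Group W] {M : CoxeterMatrix (Fin 3)} (cs : CoxeterSystem M W)
    (act : W →* Equiv.Perm E2)
    (h0 : ∀ v, act (cs.simple 0) v = reflE rho2 (-1) v)
    (h1 : ∀ v, act (cs.simple 1) v = reflE a1 0 v)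
    (h2 : ∀ v, act (cs.simple 2) v = reflE a2 0 v)
    (hcen : Function.Injective (cen act)) :
    ∃ co, IsCoord cs co ∧ ∀ w, cen act w = (co w).bary := by
  have one : cen act 1 = Tri.bary (0, 0, 0) := by
    simp only [cen, map_one, Equiv.Perm.coe_one, id_eq, Tri.bary, rho2, Prod.smul_mk]
    norm_num
  have simple : ∀ i z, act (cs.simple i) (Tri.bary z) = Tri.bary (Tri.reflect i 0 z) := by
    rintro i ⟨p, q, r⟩
    match i with
    | 0 =>
      rw [h0]
      ext <;> simp [reflE, B2, rho2, Tri.bary, Tri.reflect] <;> ring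
    | 1 =>
      rw [h1]
      ext <;> simp [reflE, B2, a1, Tri.bary, Tri.reflect] <;> ring
    | 2 =>
      rw [h2]
      ext <;> simp [reflE, B2, a2, Tri.bary, Tri.reflect] <;> ring
  have mul : ∀ i w, cen act (cs.simple i * w) = act (cs.simple i) (cen act w) := by
    intro i w
    simp only [cen, map_mul, Equiv.Perm.coe_mul, Function.comp_apply]
  have ex : ∀ w, ∃ z : Tri, z.Valid ∧ cen act w = z.bary := by
    intro w
    induction w using cs.simple_induction_left with
    | one => exact ⟨(0, 0, 0), .inl rfl, one⟩
    | mul_simple_left w i ih =>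
      obtain ⟨z, hz, e⟩ := ih
      exact ⟨Tri.reflect i 0 z, hz.reflect i 0, by rw [mul, e, simple]⟩
  choose co hco hcen' using ex
  refine ⟨co, ⟨hco, fun v w e => hcen ?_, ?_, fun i w => ?_⟩, hcen'⟩
  · rw [hcen', hcen', e]
  · exact Tri.bary_injective (hco 1) (.inl rfl) ((hcen' 1).symm.trans one)
  · refine Tri.bary_injective (hco _) ((hco w).reflect i 0) ?_
    rw [← hcen', mul, hcen', simple]

namespace Tri

theorem nonneg_of_bary_mem_Fid {z : Tri} (hz : z.Valid) (h : bary z ∈ Fid) :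
    0 ≤ z.1 ∧ 0 ≤ z.2.1 := by
  obtain ⟨p, q, r⟩ := z
  obtain ⟨h₁, h₂, -⟩ := h
  simp only [bary, B2, a1, a2] at h₁ h₂
  have h₁ : -3 ≤ 2 * (p - r - 1) - (q - r - 1) := by
    have : ((-3 : ℤ) : ℝ) ≤ ((2 * (p - r - 1) - (q - r - 1) : ℤ) : ℝ) := by
      push_cast at h₁ ⊢
      linarith
    exact_mod_cast this
  have h₂ : -3 ≤ 2 * (q - r - 1) - (p - r - 1) := by
    have : ((-3 : ℤ) : ℝ) ≤ ((2 * (q - r - 1) - (p - r - 1) : ℤ) : ℝ) := by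
      push_cast at h₂ ⊢
      linarith
    exact_mod_cast this
  simp only [Valid] at *
  omega

/-- The coordinates of the translate of an alcove by the weight `a • ϖ₁ + b • ϖ₂`. -/
theorem eq_translate {z w : Tri} (hz : z.Valid) (hw : w.Valid) (a b : ℤ)
    (h : bary w = bary z + ((a : ℝ) • fw1 + (b : ℝ) • fw2)) :
    w = (z.1 + a, z.2.1 + b, z.2.2 - a - b) := by
  obtain ⟨p, q, r⟩ := z
  refine bary_injective hw ?_ (h.trans ?_)
  · simp only [Valid] at *
    omega
  · simp only [bary, fw1, fw2]
    ext <;> simp <;> ring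

end Tri

namespace IsCoord

variable {W : Type*} [Group W] {M : CoxeterMatrix (Fin 3)} {cs : CoxeterSystem M W} {co : W → Tri}
  {act : W →* Equiv.Perm E2} {Wadd : W → E2 → W}

theorem translate (h : IsCoord cs co) (hc : ∀ w, cen act w = (co w).bary)
    (hWadd : ∀ (z : W), ∀ v ∈ wLat, cen act (Wadd z v) = cen act z + v) (z : W) (a b : ℤ)
    {v : E2} (hv : v = (a : ℝ) • fw1 + (b : ℝ) • fw2) :
    co (Wadd z v) = ((co z).1 + a, (co z).2.1 + b, (co z).2.2 - a - b) := by
  refine Tri.eq_translate (h.valid z) (h.valid _) a b ?_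
  rw [← hc, ← hc, hWadd z v ⟨a, b, hv⟩, hv]

theorem le_of_thick (h : IsCoord cs co) (hc : ∀ w, cen act w = (co w).bary)
    (hWadd : ∀ (z : W), ∀ v ∈ wLat, cen act (Wadd z v) = cen act z + v) {x y : W}
    (hxy : Thick cs act Wadd x y) :
    (2 ≤ (co x).1 ∧ 2 ≤ (co x).2.1) ∧ (4 ≤ (co y).1 ∧ 4 ≤ (co y).2.1) ∧
      (co x).1 - (co x).2.2 + 6 ≤ (co y).1 - (co y).2.2 ∧
      (co x).2.1 - (co x).2.2 + 6 ≤ (co y).2.1 - (co y).2.2 := by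
  obtain ⟨hx₁, hx₂, -, -, hx₃, hx₄, hy₁, hy₂⟩ := hxy
  have t₁ := fun z => h.translate hc hWadd z 4 (-2) (v := (2 : ℝ) • a1)
    (by ext <;> simp [a1, fw1, fw2] <;> norm_num)
  have t₂ := fun z => h.translate hc hWadd z (-2) 4 (v := (2 : ℝ) • a2)
    (by ext <;> simp [a2, fw1, fw2] <;> norm_num)
  have t₃ := fun z => h.translate hc hWadd z (-4) 2 (v := -((2 : ℝ) • a1))
    (by ext <;> simp [a1, fw1, fw2] <;> norm_num)
  have t₄ := fun z => h.translate hc hWadd z 2 (-4) (v := -((2 : ℝ) • a2))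
    (by ext <;> simp [a2, fw1, fw2] <;> norm_num)
  have w₁ := (h.bruhatLE_iff.1 hx₁.2).width_le (h.valid _)
  have w₂ := (h.bruhatLE_iff.1 hx₂.2).width_le (h.valid _)
  rw [hc] at hx₃ hx₄ hy₁ hy₂
  have hx₃ := Tri.nonneg_of_bary_mem_Fid (h.valid _) hx₃
  have hx₄ := Tri.nonneg_of_bary_mem_Fid (h.valid _) hx₄
  have hy₁ := Tri.nonneg_of_bary_mem_Fid (h.valid _) hy₁
  have hy₂ := Tri.nonneg_of_bary_mem_Fid (h.valid _) hy₂
  have vx := h.valid x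
  have vy := h.valid y
  rw [t₁] at w₁ hx₃
  rw [t₂] at w₂ hx₄
  rw [t₃] at hy₁
  rw [t₄] at hy₂
  clear t₁ t₂ t₃ t₄
  generalize co x = u at *
  generalize co y = v at *
  simp only [Tri.Valid, Tri.width₁, Tri.width₂] at *
  omega

end IsCoord

/-- a poset isomorphism between thick intervals sends `x + ρ` to `x' + ρ`. -/
theorem statement12
    {W : Type*} [Group W] {M : CoxeterMatrix (Fin 3)} (cs : CoxeterSystem M W)
    (hM : ∀ i j : Fin 3, M i j = if i = j then 1 else 3)
    (act : W →* Equiv.Perm E2)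
    (h0 : ∀ v, act (cs.simple 0) v = reflE rho2 (-1) v)
    (h1 : ∀ v, act (cs.simple 1) v = reflE a1 0 v)
    (h2 : ∀ v, act (cs.simple 2) v = reflE a2 0 v)
    (hcen : Function.Injective (cen act))
    (th ths : ℕ → ℕ → W)
    (hth : ∀ m n : ℕ, cen act (th m n) =
      cen act (cs.simple 1 * cs.simple 2 * cs.simple 1) + (m : ℝ) • fw1 + (n : ℝ) • fw2)
    (hths : ∀ m n : ℕ, cen act (ths m n) =
      cen act 1 + ((m : ℝ) + 1) • fw1 + ((n : ℝ) + 1) • fw2)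
    (Wadd : W → E2 → W)
    (hWadd : ∀ (z : W), ∀ v ∈ wLat, cen act (Wadd z v) = cen act z + v)
    (x y x' y' : W) (hx : x ∈ Dset th ths) (hy : y ∈ Dset th ths)
    (hx' : x' ∈ Dset th ths) (hy' : y' ∈ Dset th ths)
    (hxy : bruhatLE cs x y) (hxy' : bruhatLE cs x' y')
    (hthick : Thick cs act Wadd x y) (hthick' : Thick cs act Wadd x' y')
    (phi : {z : W // bruhatLE cs x z ∧ bruhatLE cs z y} ≃
           {z : W // bruhatLE cs x' z ∧ bruhatLE cs z y'})
    (hphi : ∀ u v, bruhatLE cs u.1 v.1 ↔ bruhatLE cs (phi u).1 (phi v).1) :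
    ∀ h : bruhatLE cs x (Wadd x rho2) ∧ bruhatLE cs (Wadd x rho2) y,
      (phi ⟨Wadd x rho2, h⟩).1 = Wadd x' rho2 := by
  intro h
  obtain ⟨co, hco, hc⟩ := exists_isCoord cs act h0 h1 h2 hcen
  have translate_rho : ∀ z, co (Wadd z rho2) = Tri.addRho (co z) := by
    intro z
    rw [hco.translate hc hWadd z 1 1 (by ext <;> simp [rho2, fw1, fw2] <;> norm_num)]
    simp only [Tri.addRho, Prod.mk.injEq, true_and]
    omega
  obtain ⟨hx₁, -⟩ := hco.le_of_thick hc hWadd hthick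
  obtain ⟨hx₁', hy₁', h₁, h₂⟩ := hco.le_of_thick hc hWadd hthick'
  refine hco.apply_eq_addRho hx₁ hx₁' (translate_rho x) (translate_rho x') ?_ phi hphi h
  refine hco.bruhatLE_of_reach ?_
  rw [translate_rho]
  exact Tri.reach_addRho (hco.valid x') (hco.valid y') (by omega) (by omega) (by omega)
    (by omega) h₁ h₂
end
end
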